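/- arXiv:1812.02680 — 2 statements merged into one kernel-verified Lean document; each statement's English description precedes it below -/
import Mathlib

section
/- Suppose u ↦ |Φ(u)| · |det A(u)|^{-1/2} is μ-integrable and the matrices A(u) pairwise commute for μ-a.e. pairs u, v. Let T be a continuous linear operator on L²(ℝⁿ; ℂ) such that for every f ∈ L², (Tf)(x) = ∫_Ω Φ(u) f(A(u)x) dμ(u) for a.e. x. Then the Hilbert-space adjoint T† satisfies (T† g)(x) = ∫_Ω conj(Φ(v)) |det A(v)|^{-1} g(A(v)^{-1}x) dμ(v) a.e. for every g ∈ L², and T is normal: T ∘ T† = T† ∘ T. -/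
open MeasureTheory Complex Filter Matrix
open scoped ENNReal ComplexConjugate

section LinearSubstitution

variable {n : ℕ} {B C : Matrix (Fin n) (Fin n) ℝ}

theorem measurable_mulVec (B : Matrix (Fin n) (Fin n) ℝ) :
    Measurable fun x : Fin n → ℝ => B *ᵥ x :=
  (B.mulVecLin.continuous_of_finiteDimensional).measurable

theorem map_mulVec_volume (hB : B.det ≠ 0) :
    Measure.map (fun x : Fin n → ℝ => B *ᵥ x) volume =
      ENNReal.ofReal |B.det|⁻¹ • (volume : Measure (Fin n → ℝ)) := by
  rw [← abs_inv, ← Real.map_matrix_volume_pi_eq_smul_volume_pi hB]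
  rfl

theorem quasiMeasurePreserving_mulVec (hB : B.det ≠ 0) :
    Measure.QuasiMeasurePreserving (fun x : Fin n → ℝ => B *ᵥ x) volume volume :=
  ⟨measurable_mulVec B, by rw [map_mulVec_volume hB]; exact Measure.smul_absolutelyContinuous⟩

theorem eLpNorm_comp_mulVec (hB : B.det ≠ 0) {f : (Fin n → ℝ) → ℂ}
    (hf : AEStronglyMeasurable f volume) :
    eLpNorm (fun x => f (B *ᵥ x)) 2 volume =
      ENNReal.ofReal (|B.det| ^ (-((1 : ℝ) / 2))) * eLpNorm f 2 volume := by
  have hpos : 0 < |B.det|⁻¹ := by positivity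
  have hf' : AEStronglyMeasurable f (Measure.map (fun x : Fin n → ℝ => B *ᵥ x) volume) :=
    hf.mono_ac (quasiMeasurePreserving_mulVec hB).absolutelyContinuous
  have h := eLpNorm_map_measure (p := 2) hf' (measurable_mulVec B).aemeasurable
  rw [map_mulVec_volume hB,
    eLpNorm_smul_measure_of_ne_zero (by simpa using hpos)] at h
  change eLpNorm (f ∘ fun x => B *ᵥ x) 2 volume = _
  rw [← h, smul_eq_mul, ENNReal.ofReal_rpow_of_pos hpos, Real.inv_rpow (abs_nonneg _),
    Real.rpow_neg (abs_nonneg _)]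
  norm_num

theorem memLp_comp_mulVec (hB : B.det ≠ 0) {f : (Fin n → ℝ) → ℂ} (hf : MemLp f 2 volume) :
    MemLp (fun x => f (B *ᵥ x)) 2 volume := by
  refine ⟨hf.1.comp_quasiMeasurePreserving (quasiMeasurePreserving_mulVec hB), ?_⟩
  rw [eLpNorm_comp_mulVec hB hf.1]
  exact ENNReal.mul_lt_top ENNReal.ofReal_lt_top hf.2

/-- The substitution operator `f ↦ f ∘ B` on `L²(ℝⁿ)` for an invertible matrix `B`. -/
noncomputable def substLp (B : Matrix (Fin n) (Fin n) ℝ) (hB : B.det ≠ 0) :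
    Lp ℂ 2 (volume : Measure (Fin n → ℝ)) →L[ℂ] Lp ℂ 2 (volume : Measure (Fin n → ℝ)) :=
  LinearMap.mkContinuous
    { toFun := fun f => (memLp_comp_mulVec hB (Lp.memLp f)).toLp _
      map_add' := fun f g => by
        rw [← MemLp.toLp_add, MemLp.toLp_eq_toLp_iff]
        exact (quasiMeasurePreserving_mulVec hB).ae (Lp.coeFn_add f g)
      map_smul' := fun c f => by
        rw [RingHom.id_apply, ← MemLp.toLp_const_smul, MemLp.toLp_eq_toLp_iff]
        exact (quasiMeasurePreserving_mulVec hB).ae (Lp.coeFn_smul c f) }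
    (|B.det| ^ (-((1 : ℝ) / 2))) fun f => by
      simp only [LinearMap.coe_mk, AddHom.coe_mk, Lp.norm_toLp]
      rw [eLpNorm_comp_mulVec hB (Lp.aestronglyMeasurable f), ENNReal.toReal_mul,
        ENNReal.toReal_ofReal (by positivity), Lp.norm_def]

theorem substLp_coeFn (hB : B.det ≠ 0) (f : Lp ℂ 2 (volume : Measure (Fin n → ℝ))) :
    substLp B hB f =ᵐ[volume] fun x => f (B *ᵥ x) :=
  MemLp.coeFn_toLp (memLp_comp_mulVec hB (Lp.memLp f))

theorem norm_substLp_le (hB : B.det ≠ 0) (f : Lp ℂ 2 (volume : Measure (Fin n → ℝ))) :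
    ‖substLp B hB f‖ ≤ |B.det| ^ (-((1 : ℝ) / 2)) * ‖f‖ :=
  ContinuousLinearMap.le_of_opNorm_le _ (LinearMap.mkContinuous_norm_le _ (by positivity) _) f

theorem substLp_substLp (hB : B.det ≠ 0) (hC : C.det ≠ 0) (hCB : (C * B).det ≠ 0)
    (f : Lp ℂ 2 (volume : Measure (Fin n → ℝ))) :
    substLp B hB (substLp C hC f) = substLp (C * B) hCB f := by
  apply Lp.ext
  filter_upwards [substLp_coeFn hB (substLp C hC f), substLp_coeFn hCB f,
    (quasiMeasurePreserving_mulVec hB).ae (substLp_coeFn hC f)] with x h₁ h₂ h₃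
  rw [h₁, h₂, h₃, mulVec_mulVec]

theorem det_inv_ne_zero (hB : B.det ≠ 0) : B⁻¹.det ≠ 0 := by
  rw [det_nonsing_inv, Ring.inverse_eq_inv']
  exact inv_ne_zero hB

theorem integral_comp_mulVec (hB : B.det ≠ 0) {F : (Fin n → ℝ) → ℂ}
    (hF : AEStronglyMeasurable F volume) :
    ∫ x, F (B *ᵥ x) = ((|B.det|⁻¹ : ℝ) : ℂ) * ∫ x, F x := by
  have hF' : AEStronglyMeasurable F (Measure.map (fun x : Fin n → ℝ => B *ᵥ x) volume) :=
    hF.mono_ac (quasiMeasurePreserving_mulVec hB).absolutelyContinuous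
  rw [← integral_map (measurable_mulVec B).aemeasurable hF', map_mulVec_volume hB,
    integral_smul_measure, ENNReal.toReal_ofReal (by positivity), Complex.real_smul]

theorem adjoint_substLp (hB : B.det ≠ 0) :
    ContinuousLinearMap.adjoint (substLp B hB) =
      ((|B.det|⁻¹ : ℝ) : ℂ) • substLp B⁻¹ (det_inv_ne_zero hB) := by
  symm
  rw [ContinuousLinearMap.eq_adjoint_iff]
  intro f g
  rw [_root_.smul_apply, inner_smul_left, L2.inner_def, L2.inner_def, conj_ofReal]
  have hF : AEStronglyMeasurable (fun x => inner ℂ (f (B⁻¹ *ᵥ x)) (g x)) volume :=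
    ((Lp.aestronglyMeasurable f).comp_quasiMeasurePreserving
      (quasiMeasurePreserving_mulVec (det_inv_ne_zero hB))).inner (Lp.aestronglyMeasurable g)
  have hu : IsUnit B.det := isUnit_iff_ne_zero.mpr hB
  have h₁ : ∫ x, inner ℂ (substLp B⁻¹ (det_inv_ne_zero hB) f x) (g x) =
      ∫ x, inner ℂ (f (B⁻¹ *ᵥ x)) (g x) :=
    integral_congr_ae ((substLp_coeFn (det_inv_ne_zero hB) f).mono fun x hx => by simp only [hx])
  have h₂ : ∫ x, inner ℂ (f x) (substLp B hB g x) =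
      ∫ x, inner ℂ (f (B⁻¹ *ᵥ (B *ᵥ x))) (g (B *ᵥ x)) :=
    integral_congr_ae ((substLp_coeFn hB g).mono fun x hx => by
      simp only [hx, mulVec_mulVec, nonsing_inv_mul _ hu, one_mulVec])
  rw [h₁, h₂, integral_comp_mulVec hB hF]

theorem substLp_adjoint_substLp (hB : B.det ≠ 0) (hC : C.det ≠ 0) (h : B * C = C * B)
    (f : Lp ℂ 2 (volume : Measure (Fin n → ℝ))) :
    substLp C hC (ContinuousLinearMap.adjoint (substLp B hB) f) =
      ContinuousLinearMap.adjoint (substLp B hB) (substLp C hC f) := by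
  have hB' := det_inv_ne_zero hB
  have hcomm : C * B⁻¹ = B⁻¹ * C := by
    have hu : IsUnit B.det := isUnit_iff_ne_zero.mpr hB
    calc C * B⁻¹ = B⁻¹ * (B * C) * B⁻¹ := by
          rw [← Matrix.mul_assoc, nonsing_inv_mul _ hu, Matrix.one_mul]
      _ = B⁻¹ * C := by
          rw [h, Matrix.mul_assoc, Matrix.mul_assoc, mul_nonsing_inv _ hu, Matrix.mul_one]
  have hCB : (C * B⁻¹).det ≠ 0 := by rw [det_mul]; exact mul_ne_zero hC hB'
  have hBC : (B⁻¹ * C).det ≠ 0 := hcomm ▸ hCB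
  simp only [adjoint_substLp, _root_.smul_apply, map_smul]
  rw [substLp_substLp hC hB' hBC, substLp_substLp hB' hC hCB]
  congr 3
  exact hcomm.symm

end LinearSubstitution

/-- A weak integral `T = ∫ Φ(u) U(u) dμ(u)` of operators on a Hilbert space is normal if `U(u)†`
commutes with `U(v)` for almost all relevant `u` and `v`. -/
theorem comp_adjoint_eq_adjoint_comp_of_weak_integral {Ω H : Type*} [MeasurableSpace Ω]
    {μ : Measure Ω} [NormedAddCommGroup H] [InnerProductSpace ℂ H] [CompleteSpace H]
    {Φ : Ω → ℂ} {U : Ω → H →L[ℂ] H} {T : H →L[ℂ] H}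
    (hT : ∀ h f, inner ℂ h (T f) = ∫ u, Φ u * inner ℂ h (U u f) ∂μ)
    (hU : ∀ᵐ u ∂μ, ∀ᵐ v ∂μ, Φ u ≠ 0 → Φ v ≠ 0 → ∀ f,
      U v (ContinuousLinearMap.adjoint (U u) f) = ContinuousLinearMap.adjoint (U u) (U v f)) :
    T ∘L ContinuousLinearMap.adjoint T = ContinuousLinearMap.adjoint T ∘L T := by
  have hT' : ∀ h f, inner ℂ (T h) f = ∫ u, conj (Φ u) * inner ℂ (U u h) f ∂μ := fun h f => by
    rw [← inner_conj_symm, hT, ← integral_conj]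
    simp only [map_mul, inner_conj_symm]
  refine ContinuousLinearMap.ext fun f => ext_inner_left ℂ fun h => ?_
  simp only [ContinuousLinearMap.comp_apply]
  rw [hT, ContinuousLinearMap.adjoint_inner_right, hT]
  refine integral_congr_ae (hU.mono fun u hu => ?_)
  by_cases hΦu : Φ u = 0
  · simp [hΦu]
  simp only
  congr 1
  rw [← ContinuousLinearMap.adjoint_inner_left, ContinuousLinearMap.adjoint_inner_right, hT', hT']
  refine integral_congr_ae (hu.mono fun v hv => ?_)
  by_cases hΦv : Φ v = 0
  · simp [hΦv]
  simp only
  rw [hv hΦu hΦv, ContinuousLinearMap.adjoint_inner_left]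

section HausdorffKernel

variable {Ω : Type*} [MeasurableSpace Ω] {μ : Measure Ω} {n : ℕ}
  {Φ : Ω → ℂ} {A : Ω → Matrix (Fin n) (Fin n) ℝ}

theorem measurable_mulVec_uncurry (hA : ∀ i j, Measurable fun u => A u i j) :
    Measurable fun p : Ω × (Fin n → ℝ) => A p.1 *ᵥ p.2 := by
  refine measurable_pi_iff.mpr fun i => ?_
  simp only [mulVec, dotProduct]
  exact Finset.measurable_sum _ fun j _ =>
    ((hA i j).comp measurable_fst).mul ((measurable_pi_apply j).comp measurable_snd)

theorem measurable_mulVec_const (hA : ∀ i j, Measurable fun u => A u i j) (x : Fin n → ℝ) :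
    Measurable fun u => A u *ᵥ x :=
  (measurable_mulVec_uncurry hA).comp measurable_prodMk_right

theorem measurable_matrix_comp (hA : ∀ i j, Measurable fun u => A u i j)
    {F : Matrix (Fin n) (Fin n) ℝ → ℝ} (hF : Continuous F) : Measurable fun u => F (A u) := by
  have h : Continuous fun M : Fin n → Fin n → ℝ => F (Matrix.of M) := hF
  exact h.measurable.comp (measurable_pi_iff.mpr fun i => measurable_pi_iff.mpr fun j => hA i j)

theorem measurable_matrix_det (hA : ∀ i j, Measurable fun u => A u i j) :
    Measurable fun u => (A u).det :=
  measurable_matrix_comp hA continuous_id.matrix_det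

theorem measurable_matrix_inv (hA : ∀ i j, Measurable fun u => A u i j) (i j : Fin n) :
    Measurable fun u => (A u)⁻¹ i j := by
  have h : (fun u => (A u)⁻¹ i j) = fun u => (A u).det⁻¹ * (A u).adjugate i j := by
    funext u
    rw [Matrix.inv_def, Matrix.smul_apply, Ring.inverse_eq_inv', smul_eq_mul]
  rw [h]
  exact (measurable_matrix_det hA).inv.mul
    (measurable_matrix_comp hA (F := fun M => M.adjugate i j)
      (continuous_id.matrix_adjugate.matrix_elem i j))

theorem ae_ae_mulVec [SFinite μ] (hA : ∀ i j, Measurable fun u => A u i j)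
    (hdet : ∀ u, (A u).det ≠ 0) {p : (Fin n → ℝ) → Prop} (hp : ∀ᵐ y, p y) :
    ∀ᵐ x, ∀ᵐ u ∂μ, p (A u *ᵥ x) := by
  have hq : Measure.QuasiMeasurePreserving (fun q : (Fin n → ℝ) × Ω => A q.2 *ᵥ q.1)
      (volume.prod μ) volume :=
    QuasiMeasurePreserving.prod_of_left
      ((measurable_mulVec_uncurry hA).comp measurable_swap)
      (Eventually.of_forall fun u => quasiMeasurePreserving_mulVec (hdet u))
  exact Measure.ae_ae_of_ae_prod (hq.ae hp)

theorem integral_norm_conj_mul_le (h f : Lp ℂ 2 (volume : Measure (Fin n → ℝ))) :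
    ∫ x, ‖conj (h x) * f x‖ ≤ ‖h‖ * ‖f‖ := by
  have hc : AEStronglyMeasurable (fun x => conj (h x)) volume :=
    continuous_conj.comp_aestronglyMeasurable (Lp.aestronglyMeasurable h)
  have hle : eLpNorm (fun x => conj (h x) * f x) 1 volume ≤
      eLpNorm h 2 volume * eLpNorm f 2 volume := by
    refine (eLpNorm_smul_le_mul_eLpNorm (p := 2) (q := 2) (r := 1)
      (Lp.aestronglyMeasurable f) hc).trans_eq ?_
    congr 1
    exact eLpNorm_congr_norm_ae (Eventually.of_forall fun x => by simp)
  have hm : AEStronglyMeasurable (fun x => conj (h x) * f x) volume :=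
    hc.mul (Lp.aestronglyMeasurable f)
  rw [integral_norm_eq_lintegral_enorm hm, ← eLpNorm_one_eq_lintegral_enorm, Lp.norm_def,
    Lp.norm_def, ← ENNReal.toReal_mul]
  exact ENNReal.toReal_mono (ENNReal.mul_ne_top (Lp.eLpNorm_ne_top h) (Lp.eLpNorm_ne_top f)) hle

theorem integrable_prod_hausdorff [SFinite μ] (hA : ∀ i j, Measurable fun u => A u i j)
    (hdet : ∀ u, (A u).det ≠ 0) (hΦ : AEStronglyMeasurable Φ μ)
    (hint : Integrable (fun u => ‖Φ u‖ * |(A u).det| ^ (-((1 : ℝ) / 2))) μ)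
    (h f : Lp ℂ 2 (volume : Measure (Fin n → ℝ))) :
    Integrable (fun p : Ω × (Fin n → ℝ) => conj (h p.2) * (Φ p.1 * f (A p.1 *ᵥ p.2)))
      (μ.prod volume) := by
  have hmeas : AEStronglyMeasurable
      (fun p : Ω × (Fin n → ℝ) => conj (h p.2) * (Φ p.1 * f (A p.1 *ᵥ p.2))) (μ.prod volume) :=
    (continuous_conj.comp_aestronglyMeasurable (Lp.aestronglyMeasurable h).comp_snd).mul
      (hΦ.comp_fst.mul ((Lp.stronglyMeasurable f).measurable.comp
        (measurable_mulVec_uncurry hA)).aestronglyMeasurable)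
  have hcongr : ∀ u, (fun x => conj (h x) * (Φ u * f (A u *ᵥ x))) =ᵐ[volume]
      fun x => Φ u * (conj (h x) * substLp (A u) (hdet u) f x) := fun u =>
    (substLp_coeFn (hdet u) f).mono fun x hx => by simp only [hx]; ring
  refine (integrable_prod_iff hmeas).mpr ⟨Eventually.of_forall fun u => ?_, ?_⟩
  · refine Integrable.congr (Integrable.const_mul ?_ (Φ u)) (hcongr u).symm
    exact (Lp.memLp h).star.integrable_mul (Lp.memLp (substLp (A u) (hdet u) f))
  · refine Integrable.mono' (hint.mul_const (‖h‖ * ‖f‖)) hmeas.norm.integral_prod_right'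
      (Eventually.of_forall fun u => ?_)
    rw [Real.norm_of_nonneg (integral_nonneg fun x => norm_nonneg _)]
    calc ∫ x, ‖conj (h x) * (Φ u * f (A u *ᵥ x))‖
        = ∫ x, ‖Φ u‖ * ‖conj (h x) * substLp (A u) (hdet u) f x‖ :=
          integral_congr_ae ((hcongr u).mono fun x hx => by simp only [hx, norm_mul])
      _ ≤ ‖Φ u‖ * (‖h‖ * (|(A u).det| ^ (-((1 : ℝ) / 2)) * ‖f‖)) := by
          rw [integral_const_mul]
          gcongr
          exact (integral_norm_conj_mul_le _ _).trans
            (mul_le_mul_of_nonneg_left (norm_substLp_le _ _) (norm_nonneg _))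
      _ = ‖Φ u‖ * |(A u).det| ^ (-((1 : ℝ) / 2)) * (‖h‖ * ‖f‖) := by ring

theorem integrable_conj_mul_hausdorff [SFinite μ] (hA : ∀ i j, Measurable fun u => A u i j)
    (hdet : ∀ u, (A u).det ≠ 0) (hΦ : AEStronglyMeasurable Φ μ)
    (hint : Integrable (fun u => ‖Φ u‖ * |(A u).det| ^ (-((1 : ℝ) / 2))) μ)
    (h f : Lp ℂ 2 (volume : Measure (Fin n → ℝ))) :
    Integrable fun x => conj (h x) * ∫ u, Φ u * f (A u *ᵥ x) ∂μ := by
  simpa only [integral_const_mul] using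
    (integrable_prod_hausdorff hA hdet hΦ hint h f).integral_prod_right

theorem integral_conj_mul_hausdorff [SFinite μ] (hA : ∀ i j, Measurable fun u => A u i j)
    (hdet : ∀ u, (A u).det ≠ 0) (hΦ : AEStronglyMeasurable Φ μ)
    (hint : Integrable (fun u => ‖Φ u‖ * |(A u).det| ^ (-((1 : ℝ) / 2))) μ)
    (h f : Lp ℂ 2 (volume : Measure (Fin n → ℝ))) :
    ∫ x, conj (h x) * ∫ u, Φ u * f (A u *ᵥ x) ∂μ =
      ∫ u, Φ u * inner ℂ h (substLp (A u) (hdet u) f) ∂μ := by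
  simp only [← integral_const_mul]
  rw [← integral_integral_swap (integrable_prod_hausdorff hA hdet hΦ hint h f)]
  refine integral_congr_ae (Eventually.of_forall fun u => ?_)
  simp only
  rw [L2.inner_def, ← integral_const_mul]
  refine integral_congr_ae ((substLp_coeFn (hdet u) f).mono fun x hx => ?_)
  simp only [hx, RCLike.inner_apply]
  ring

theorem integrable_adjoint_kernel (hdet : ∀ u, (A u).det ≠ 0)
    (hint : Integrable (fun u => ‖Φ u‖ * |(A u).det| ^ (-((1 : ℝ) / 2))) μ) :
    Integrable (fun u => ‖conj (Φ u) * ((|(A u).det|⁻¹ : ℝ) : ℂ)‖ *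
      |((A u)⁻¹).det| ^ (-((1 : ℝ) / 2))) μ := by
  refine hint.congr (Eventually.of_forall fun u => ?_)
  have hpos : 0 < |(A u).det| := abs_pos.mpr (hdet u)
  simp only [norm_mul, RCLike.norm_conj, Complex.norm_real, det_nonsing_inv,
    Ring.inverse_eq_inv', abs_inv, norm_inv, Real.norm_eq_abs, abs_abs]
  rw [mul_assoc, Real.inv_rpow hpos.le, ← Real.rpow_neg hpos.le, ← Real.rpow_neg_one,
    ← Real.rpow_add hpos]
  norm_num

theorem aestronglyMeasurable_adjoint_kernel (hA : ∀ i j, Measurable fun u => A u i j)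
    (hΦ : AEStronglyMeasurable Φ μ) :
    AEStronglyMeasurable (fun u => conj (Φ u) * ((|(A u).det|⁻¹ : ℝ) : ℂ)) μ :=
  (continuous_conj.comp_aestronglyMeasurable hΦ).mul
    (measurable_ofReal.comp
      (measurable_matrix_det hA).abs.inv).aestronglyMeasurable

theorem integrable_conj_mul_adjoint_hausdorff [SFinite μ]
    (hA : ∀ i j, Measurable fun u => A u i j)
    (hdet : ∀ u, (A u).det ≠ 0) (hΦ : AEStronglyMeasurable Φ μ)
    (hint : Integrable (fun u => ‖Φ u‖ * |(A u).det| ^ (-((1 : ℝ) / 2))) μ)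
    (f g : Lp ℂ 2 (volume : Measure (Fin n → ℝ))) :
    Integrable fun x => conj (f x) *
      ∫ v, conj (Φ v) * ((|(A v).det|⁻¹ : ℝ) : ℂ) * g ((A v)⁻¹ *ᵥ x) ∂μ :=
  integrable_conj_mul_hausdorff (measurable_matrix_inv hA) (fun u => det_inv_ne_zero (hdet u))
    (aestronglyMeasurable_adjoint_kernel hA hΦ) (integrable_adjoint_kernel hdet hint) f g

theorem integral_conj_mul_adjoint_hausdorff [SFinite μ]
    (hA : ∀ i j, Measurable fun u => A u i j)
    (hdet : ∀ u, (A u).det ≠ 0) (hΦ : AEStronglyMeasurable Φ μ)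
    (hint : Integrable (fun u => ‖Φ u‖ * |(A u).det| ^ (-((1 : ℝ) / 2))) μ)
    (f g : Lp ℂ 2 (volume : Measure (Fin n → ℝ))) :
    ∫ x, conj (f x) * ∫ v, conj (Φ v) * ((|(A v).det|⁻¹ : ℝ) : ℂ) * g ((A v)⁻¹ *ᵥ x) ∂μ =
      conj (∫ x, conj (g x) * ∫ u, Φ u * f (A u *ᵥ x) ∂μ) := by
  rw [integral_conj_mul_hausdorff hA hdet hΦ hint, ← integral_conj,
    integral_conj_mul_hausdorff (measurable_matrix_inv hA) (fun u => det_inv_ne_zero (hdet u))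
      (aestronglyMeasurable_adjoint_kernel hA hΦ) (integrable_adjoint_kernel hdet hint)]
  refine integral_congr_ae (Eventually.of_forall fun u => ?_)
  simp only [map_mul, inner_conj_symm]
  rw [← ContinuousLinearMap.adjoint_inner_right, adjoint_substLp, _root_.smul_apply,
    inner_smul_right, mul_assoc]

/-- On sets of finite measure the formal adjoint Hausdorff integral is integrable, and it is
determined by testing against indicator functions. -/
theorem setIntegral_adjoint_hausdorff [SFinite μ]
    (hA : ∀ i j, Measurable fun u => A u i j)
    (hdet : ∀ u, (A u).det ≠ 0) (hΦ : AEStronglyMeasurable Φ μ)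
    (hint : Integrable (fun u => ‖Φ u‖ * |(A u).det| ^ (-((1 : ℝ) / 2))) μ)
    (g : Lp ℂ 2 (volume : Measure (Fin n → ℝ))) {s : Set (Fin n → ℝ)} (hs : MeasurableSet s)
    (hs' : volume s ≠ ∞) :
    IntegrableOn (fun x => ∫ v, conj (Φ v) * ((|(A v).det|⁻¹ : ℝ) : ℂ) * g ((A v)⁻¹ *ᵥ x) ∂μ) s ∧
    ∫ x in s, ∫ v, conj (Φ v) * ((|(A v).det|⁻¹ : ℝ) : ℂ) * g ((A v)⁻¹ *ᵥ x) ∂μ =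
      conj (∫ x, conj (g x) * ∫ u, Φ u * indicatorConstLp 2 hs hs' (1 : ℂ) (A u *ᵥ x) ∂μ) := by
  have hind : ∀ F : (Fin n → ℝ) → ℂ,
      (fun x => conj (indicatorConstLp 2 hs hs' (1 : ℂ) x) * F x) =ᵐ[volume] s.indicator F :=
    fun F => (indicatorConstLp_coeFn (p := 2) (hs := hs) (hμs := hs') (c := (1 : ℂ))).mono
      fun x hx => by
        simp only [hx]
        by_cases hxs : x ∈ s <;> simp [hxs]
  constructor
  · rw [← integrable_indicator_iff hs]
    exact (integrable_conj_mul_adjoint_hausdorff hA hdet hΦ hint _ g).congr (hind _)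
  · rw [← integral_conj_mul_adjoint_hausdorff hA hdet hΦ hint, ← integral_indicator hs]
    exact (integral_congr_ae (hind _)).symm

theorem exists_maximal_aemeasurable_restrict (μ : Measure Ω) [SFinite μ] (Φ : Ω → ℂ) :
    ∃ S, MeasurableSet S ∧ AEMeasurable Φ (μ.restrict S) ∧
      ∀ t, MeasurableSet t → AEMeasurable Φ (μ.restrict t) → μ (t \ S) = 0 := by
  set c := {t : Set Ω | MeasurableSet t ∧ AEMeasurable Φ (μ.restrict t)} with hc
  have hne : (μ.toFinite '' c).Nonempty := ⟨_, ∅, by simp [hc], rfl⟩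
  obtain ⟨r, -, hr, hrc⟩ := exists_seq_tendsto_sSup hne (OrderTop.bddAbove _)
  choose s hs hsr using hrc
  have hS : (⋃ k, s k) ∈ c :=
    ⟨MeasurableSet.iUnion fun k => (hs k).1, aemeasurable_iUnion_iff.mpr fun k => (hs k).2⟩
  refine ⟨⋃ k, s k, hS.1, hS.2, fun t ht htΦ => ?_⟩
  have hle : sSup (μ.toFinite '' c) ≤ μ.toFinite (⋃ k, s k) :=
    le_of_tendsto' hr fun k => hsr k ▸ measure_mono (Set.subset_iUnion s k)
  have hun : μ.toFinite ((⋃ k, s k) ∪ t) ≤ μ.toFinite (⋃ k, s k) :=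
    (le_sSup (Set.mem_image_of_mem μ.toFinite
      (show _ ∈ c from ⟨hS.1.union ht, aemeasurable_union_iff.mpr ⟨hS.2, htΦ⟩⟩))).trans hle
  rw [← toFinite_apply_eq_zero_iff]
  rw [← measure_add_sdiff hS.1.nullMeasurableSet] at hun
  exact nonpos_iff_eq_zero.mp
    ((ENNReal.add_le_add_iff_left (measure_ne_top _ _)).mp (by simpa using hun))

theorem ae_eq_zero_of_aestronglyMeasurable_mul {S : Set Ω}
    (hmax : ∀ t, MeasurableSet t → AEMeasurable Φ (μ.restrict t) → μ (t \ S) = 0)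
    {p : Ω → ℂ} (hp : Measurable p) (h : AEStronglyMeasurable (fun v => Φ v * p v) μ) :
    ∀ᵐ v ∂μ, v ∉ S → p v = 0 := by
  have ht : MeasurableSet {v | p v ≠ 0} := hp (measurableSet_singleton 0).compl
  have htΦ : AEMeasurable Φ (μ.restrict {v | p v ≠ 0}) := by
    refine ((h.aemeasurable.mul hp.inv.aemeasurable).mono_measure Measure.restrict_le_self).congr ?_
    filter_upwards [ae_restrict_mem ht] with v hv
    simp only [Pi.mul_apply, Pi.inv_apply]
    rw [mul_assoc, mul_inv_cancel₀ hv, mul_one]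
  refine measure_mono_null (fun v hv => ?_) (hmax _ ht htΦ)
  simp only [Set.mem_compl_iff, Set.mem_ofPred_eq, not_forall] at hv
  exact ⟨hv.2, hv.1⟩

theorem exists_sub_eq_of_ae_ne_zero {X : Type*} [MeasurableSpace X] (ν : Measure X) [SigmaFinite ν]
    (f : Lp ℂ 2 ν) :
    ∃ f₁ f₂ : Lp ℂ 2 ν, (∀ᵐ x ∂ν, f₁ x ≠ 0) ∧ (∀ᵐ x ∂ν, f₂ x ≠ 0) ∧ f = f₁ - f₂ := by
  obtain ⟨w, hpos, hw, hlt⟩ := exists_pos_lintegral_lt_of_sigmaFinite ν one_ne_zero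
  let h : X → ℂ := fun x => (Real.sqrt (w x) : ℂ)
  have hh0 : ∀ x, h x ≠ 0 := fun x => by
    simpa [h] using (hpos x).ne'
  have hhm : Measurable h :=
    measurable_ofReal.comp (Real.continuous_sqrt.measurable.comp hw.coe_nnreal_real)
  have hh : MemLp h 2 ν := by
    rw [memLp_two_iff_integrable_sq_norm hhm.aestronglyMeasurable]
    have : (fun x => ‖h x‖ ^ 2) = fun x => (w x : ℝ) := by
      funext x
      simp [h, Real.sq_sqrt]
    rw [this]
    refine ⟨hw.coe_nnreal_real.aestronglyMeasurable, ?_⟩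
    simpa [HasFiniteIntegral] using hlt.trans ENNReal.one_lt_top
  classical
  let k : X → ℂ := fun x => if f x = -h x then 2 * h x else h x
  have hkm : Measurable k := Measurable.ite
    (measurableSet_eq_fun (Lp.stronglyMeasurable f).measurable hhm.neg) (hhm.const_mul 2) hhm
  have hk : MemLp k 2 ν := by
    refine (hh.const_mul 2).mono hkm.aestronglyMeasurable (Eventually.of_forall fun x => ?_)
    simp only [k]
    split_ifs
    · exact le_rfl
    · rw [norm_mul]
      norm_num
      linarith [norm_nonneg (h x)]
  refine ⟨f + hk.toLp k, hk.toLp k, ?_, ?_, by simp⟩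
  · filter_upwards [Lp.coeFn_add f (hk.toLp k), hk.coeFn_toLp] with x h₁ h₂
    rw [h₁, Pi.add_apply, h₂]
    simp only [k]
    split_ifs with hx
    · rw [hx]
      simpa [two_mul] using hh0 x
    · exact fun h => hx (eq_neg_of_add_eq_zero_left h)
  · filter_upwards [hk.coeFn_toLp] with x h₂
    rw [h₂]
    simp only [k]
    split_ifs
    · simpa using hh0 x
    · exact hh0 x

variable [SigmaFinite μ]
  {T : Lp ℂ 2 (volume : Measure (Fin n → ℝ)) →L[ℂ] Lp ℂ 2 (volume : Measure (Fin n → ℝ))}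

theorem hausdorff_eq_zero_of_not_aemeasurable (hA : ∀ i j, Measurable fun u => A u i j)
    (hdet : ∀ u, (A u).det ≠ 0) (hΦ : ¬ AEMeasurable Φ μ)
    (hT : ∀ f : Lp ℂ 2 (volume : Measure (Fin n → ℝ)),
      ∀ᵐ x : Fin n → ℝ ∂volume, T f x = ∫ u, Φ u * f (A u *ᵥ x) ∂μ) :
    T = 0 := by
  have hne : ∀ f : Lp ℂ 2 (volume : Measure (Fin n → ℝ)), (∀ᵐ x, f x ≠ 0) → T f = 0 := by
    intro f hf
    apply Lp.ext
    filter_upwards [hT f, ae_ae_mulVec (μ := μ) hA hdet hf, Lp.coeFn_zero ℂ 2 volume]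
      with x h₁ h₂ h₃
    rw [h₁, h₃, Pi.zero_apply]
    refine integral_non_aestronglyMeasurable fun h => hΦ ?_
    have hp : Measurable fun u => f (A u *ᵥ x) :=
      (Lp.stronglyMeasurable f).measurable.comp (measurable_mulVec_const hA x)
    refine (h.aemeasurable.mul hp.inv.aemeasurable).congr (h₂.mono fun u hu => ?_)
    simp only [Pi.mul_apply, Pi.inv_apply]
    rw [mul_assoc, mul_inv_cancel₀ hu, mul_one]
  refine ContinuousLinearMap.ext fun f => ?_
  obtain ⟨f₁, f₂, h₁, h₂, rfl⟩ := exists_sub_eq_of_ae_ne_zero volume f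
  rw [map_sub, hne f₁ h₁, hne f₂ h₂, sub_zero, _root_.zero_apply]

theorem measurableSet_ae {X Y : Type*} [MeasurableSpace X] [MeasurableSpace Y] (ν : Measure Y)
    [SFinite ν] {p : X → Y → Prop} (hp : MeasurableSet {q : X × Y | p q.1 q.2}) :
    MeasurableSet {x | ∀ᵐ y ∂ν, p x y} :=
  (measurable_measure_prodMk_left (ν := ν) hp.compl) (measurableSet_singleton 0)

theorem measurableSet_comp_mulVec_eq_zero (hA : ∀ i j, Measurable fun u => A u i j)
    {S : Set Ω} (hS : MeasurableSet S) {g : (Fin n → ℝ) → ℂ} (hg : Measurable g) :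
    MeasurableSet {q : (Fin n → ℝ) × Ω | q.2 ∉ S → g (A q.2 *ᵥ q.1) = 0} := by
  have hgA : Measurable fun q : (Fin n → ℝ) × Ω => g (A q.2 *ᵥ q.1) :=
    hg.comp ((measurable_mulVec_uncurry hA).comp measurable_swap)
  exact MeasurableSet.imp (measurable_snd hS.compl) (hgA (measurableSet_singleton 0))

/-- If `g ∘ A(v)⁻¹` vanishes on `X` for almost all `v ∉ S`, then `A(v)` maps almost no point of the
support of `g` into `X`. -/
theorem ae_ae_eq_zero_of_mulVec_mem (hA : ∀ i j, Measurable fun u => A u i j)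
    (hdet : ∀ u, (A u).det ≠ 0) {S : Set Ω} (hS : MeasurableSet S)
    {g : (Fin n → ℝ) → ℂ} (hg : Measurable g) {X : Set (Fin n → ℝ)} (hX : MeasurableSet X)
    (hXg : ∀ x ∈ X, ∀ᵐ v ∂μ, v ∉ S → g ((A v)⁻¹ *ᵥ x) = 0) :
    ∀ᵐ y, ∀ᵐ v ∂μ, A v *ᵥ y ∈ X → v ∉ S → g y = 0 := by
  have h₁ : ∀ᵐ v ∂μ, ∀ᵐ x, x ∈ X → v ∉ S → g ((A v)⁻¹ *ᵥ x) = 0 := by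
    refine (Measure.ae_ae_comm (μ := volume) (ν := μ)
      (p := fun x v => x ∈ X → v ∉ S → g ((A v)⁻¹ *ᵥ x) = 0) ?_).mp
      (Eventually.of_forall fun x => ?_)
    · exact MeasurableSet.imp (measurable_fst hX)
        (measurableSet_comp_mulVec_eq_zero (measurable_matrix_inv hA) hS hg)
    · by_cases hx : x ∈ X
      · exact (hXg x hx).mono fun v hv _ => hv
      · exact Eventually.of_forall fun v hv => absurd hv hx
  refine (Measure.ae_ae_comm (μ := μ) (ν := volume)
    (p := fun v y => A v *ᵥ y ∈ X → v ∉ S → g y = 0) ?_).mp (h₁.mono fun v hv => ?_)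
  · exact MeasurableSet.imp ((measurable_mulVec_uncurry hA) hX)
      (MeasurableSet.imp (measurable_fst hS.compl)
        ((hg.comp measurable_snd) (measurableSet_singleton 0)))
  · filter_upwards [(quasiMeasurePreserving_mulVec (hdet v)).ae hv] with y hy
    rwa [mulVec_mulVec, nonsing_inv_mul _ (isUnit_iff_ne_zero.mpr (hdet v)), one_mulVec] at hy

theorem adjoint_hausdorff_ae_eq_zero (hA : ∀ i j, Measurable fun u => A u i j)
    (hdet : ∀ u, (A u).det ≠ 0)
    (hint : Integrable (fun u => ‖Φ u‖ * |(A u).det| ^ (-((1 : ℝ) / 2))) μ)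
    (hT : ∀ f : Lp ℂ 2 (volume : Measure (Fin n → ℝ)),
      ∀ᵐ x : Fin n → ℝ ∂volume, ∫ u, Φ u * f (A u *ᵥ x) ∂μ = 0)
    (g : Lp ℂ 2 (volume : Measure (Fin n → ℝ))) :
    ∀ᵐ x, ∫ v, conj (Φ v) * ((|(A v).det|⁻¹ : ℝ) : ℂ) * g ((A v)⁻¹ *ᵥ x) ∂μ = 0 := by
  obtain ⟨S, hS, hSΦ, hmax⟩ := exists_maximal_aemeasurable_restrict μ Φ
  have hgm : Measurable g := (Lp.stronglyMeasurable g).measurable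
  -- The points at which the values of `Φ` outside `S` do not contribute to the integral.
  obtain ⟨X, hXm, hX⟩ : ∃ X : Set (Fin n → ℝ), MeasurableSet X ∧
      ∀ x, x ∈ X ↔ ∀ᵐ v ∂μ, v ∉ S → g ((A v)⁻¹ *ᵥ x) = 0 :=
    ⟨{x | ∀ᵐ v ∂μ, v ∉ S → g ((A v)⁻¹ *ᵥ x) = 0}, measurableSet_ae μ
      (measurableSet_comp_mulVec_eq_zero (measurable_matrix_inv hA) hS hgm), fun x => Iff.rfl⟩
  have hXg := ae_ae_eq_zero_of_mulVec_mem hA hdet hS hgm hXm fun x hx => (hX x).mp hx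
  set G : (Fin n → ℝ) → ℂ := fun x =>
    ∫ v in S, conj (Φ v) * ((|(A v).det|⁻¹ : ℝ) : ℂ) * g ((A v)⁻¹ *ᵥ x) ∂μ with hG
  have htest : ∀ {s : Set (Fin n → ℝ)}, MeasurableSet s → volume s < ∞ →
      IntegrableOn G (s ∩ X) ∧ ∫ x in s ∩ X, G x = 0 := by
    intro s hs hs'
    have hsX := hs.inter hXm
    have hsX' : volume (s ∩ X) ≠ ∞ := measure_inter_ne_top_of_left_ne_top hs'.ne
    obtain ⟨h₁, h₂⟩ := setIntegral_adjoint_hausdorff (μ := μ.restrict S) hA hdet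
      hSΦ.aestronglyMeasurable hint.restrict g hsX hsX'
    refine ⟨h₁, h₂.trans ?_⟩
    rw [integral_eq_zero_of_ae, map_zero]
    have hind := ae_ae_mulVec (μ := μ) hA hdet
      (indicatorConstLp_coeFn (p := 2) (hs := hsX) (hμs := hsX') (c := (1 : ℂ)))
    filter_upwards [hXg, hind, hT (indicatorConstLp 2 hsX hsX' (1 : ℂ))] with y hy₁ hy₂ hy₃
    by_cases hgy : g y = 0
    · simp [hgy]
    · rw [setIntegral_eq_integral_of_ae_compl_eq_zero, hy₃, mul_zero, Pi.zero_apply]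
      filter_upwards [hy₁, hy₂] with v hv₁ hv₂ hvS
      rw [hv₂, Set.indicator_of_notMem fun h => hgy (hv₁ h.2 hvS), mul_zero]
  have hzero : X.indicator G =ᵐ[volume] fun _ => 0 := by
    refine ae_eq_of_forall_setIntegral_eq_of_sigmaFinite (fun s hs hs' => ?_)
      (fun s _ _ => integrableOn_zero) fun s hs hs' => ?_
    · rw [IntegrableOn, integrable_indicator_iff hXm, IntegrableOn,
        Measure.restrict_restrict hXm, Set.inter_comm]
      exact (htest hs hs').1
    · rw [setIntegral_indicator hXm, (htest hs hs').2, integral_zero]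
  filter_upwards [hzero] with x hx
  by_cases hxX : x ∈ X
  · rw [Set.indicator_of_mem hxX] at hx
    rw [← hx, hG]
    refine (setIntegral_eq_integral_of_ae_compl_eq_zero ?_).symm
    exact ((hX x).mp hxX).mono fun v hv hvS => by
      rw [hv hvS, mul_zero]
  · refine integral_non_aestronglyMeasurable fun h => hxX ((hX x).mpr ?_)
    have hp : Measurable fun v => ((|(A v).det|⁻¹ : ℝ) : ℂ) * conj (g ((A v)⁻¹ *ᵥ x)) :=
      (measurable_ofReal.comp (measurable_matrix_det hA).abs.inv).mul
        (continuous_conj.measurable.comp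
          (hgm.comp (measurable_mulVec_const (measurable_matrix_inv hA) x)))
    have h' := ae_eq_zero_of_aestronglyMeasurable_mul hmax hp
      ((continuous_conj.comp_aestronglyMeasurable h).congr (Eventually.of_forall fun v => by
        simp [mul_assoc]))
    filter_upwards [h'] with v hv hvS
    simpa [hdet v] using hv hvS

theorem adjoint_hausdorff_ae_eq (hA : ∀ i j, Measurable fun u => A u i j)
    (hdet : ∀ u, (A u).det ≠ 0) (hΦ : AEStronglyMeasurable Φ μ)
    (hint : Integrable (fun u => ‖Φ u‖ * |(A u).det| ^ (-((1 : ℝ) / 2))) μ)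
    (hT : ∀ f : Lp ℂ 2 (volume : Measure (Fin n → ℝ)),
      ∀ᵐ x : Fin n → ℝ ∂volume, T f x = ∫ u, Φ u * f (A u *ᵥ x) ∂μ)
    (g : Lp ℂ 2 (volume : Measure (Fin n → ℝ))) :
    ∀ᵐ x, ContinuousLinearMap.adjoint T g x =
      ∫ v, conj (Φ v) * ((|(A v).det|⁻¹ : ℝ) : ℂ) * g ((A v)⁻¹ *ᵥ x) ∂μ := by
  refine ae_eq_of_forall_setIntegral_eq_of_sigmaFinite
    (fun s _ hs' => integrableOn_Lp_of_measure_ne_top _ fact_one_le_two_ennreal.elim hs'.ne)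
    (fun s hs hs' => (setIntegral_adjoint_hausdorff hA hdet hΦ hint g hs hs'.ne).1)
    fun s hs hs' => ?_
  rw [(setIntegral_adjoint_hausdorff hA hdet hΦ hint g hs hs'.ne).2,
    ← L2.inner_indicatorConstLp_one hs hs'.ne, ContinuousLinearMap.adjoint_inner_right,
    ← inner_conj_symm, L2.inner_def]
  congr 1
  refine integral_congr_ae ?_
  filter_upwards [hT (indicatorConstLp 2 hs hs'.ne (1 : ℂ))] with x hx
  simp only [hx, RCLike.inner_apply, mul_comm]

theorem hausdorff_normal_of_aestronglyMeasurable (hA : ∀ i j, Measurable fun u => A u i j)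
    (hdet : ∀ u, (A u).det ≠ 0) (hΦ : AEStronglyMeasurable Φ μ)
    (hint : Integrable (fun u => ‖Φ u‖ * |(A u).det| ^ (-((1 : ℝ) / 2))) μ)
    (hcomm : ∀ᵐ u ∂μ, ∀ᵐ v ∂μ, Φ u ≠ 0 → Φ v ≠ 0 → A u * A v = A v * A u)
    (hT : ∀ f : Lp ℂ 2 (volume : Measure (Fin n → ℝ)),
      ∀ᵐ x : Fin n → ℝ ∂volume, T f x = ∫ u, Φ u * f (A u *ᵥ x) ∂μ) :
    T ∘L ContinuousLinearMap.adjoint T = ContinuousLinearMap.adjoint T ∘L T := by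
  refine comp_adjoint_eq_adjoint_comp_of_weak_integral (μ := μ) (Φ := Φ)
    (U := fun u => substLp (A u) (hdet u)) (fun h f => ?_) ?_
  · rw [← integral_conj_mul_hausdorff hA hdet hΦ hint, L2.inner_def]
    refine integral_congr_ae ((hT f).mono fun x hx => ?_)
    simp only [hx, RCLike.inner_apply, mul_comm]
  · exact hcomm.mono fun u hu => hu.mono fun v huv hΦu hΦv f =>
      substLp_adjoint_substLp (hdet u) (hdet v) (huv hΦu hΦv) f

theorem hausdorff_normal_and_adjoint_of_det_ne_zero (hA : ∀ i j, Measurable fun u => A u i j)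
    (hdet : ∀ u, (A u).det ≠ 0)
    (hint : Integrable (fun u => ‖Φ u‖ * |(A u).det| ^ (-((1 : ℝ) / 2))) μ)
    (hcomm : ∀ᵐ u ∂μ, ∀ᵐ v ∂μ, Φ u ≠ 0 → Φ v ≠ 0 → A u * A v = A v * A u)
    (hT : ∀ f : Lp ℂ 2 (volume : Measure (Fin n → ℝ)),
      ∀ᵐ x : Fin n → ℝ ∂volume, T f x = ∫ u, Φ u * f (A u *ᵥ x) ∂μ) :
    (∀ g : Lp ℂ 2 (volume : Measure (Fin n → ℝ)),
      ∀ᵐ x, ContinuousLinearMap.adjoint T g x =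
        ∫ v, conj (Φ v) * ((|(A v).det|⁻¹ : ℝ) : ℂ) * g ((A v)⁻¹ *ᵥ x) ∂μ) ∧
    T ∘L ContinuousLinearMap.adjoint T = ContinuousLinearMap.adjoint T ∘L T := by
  by_cases hΦ : AEMeasurable Φ μ
  · exact ⟨adjoint_hausdorff_ae_eq hA hdet hΦ.aestronglyMeasurable hint hT,
      hausdorff_normal_of_aestronglyMeasurable hA hdet hΦ.aestronglyMeasurable hint hcomm hT⟩
  · obtain rfl := hausdorff_eq_zero_of_not_aemeasurable hA hdet hΦ hT
    refine ⟨fun g => ?_, by simp⟩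
    have hT0 : ∀ f : Lp ℂ 2 (volume : Measure (Fin n → ℝ)),
        ∀ᵐ x : Fin n → ℝ ∂volume, ∫ u, Φ u * f (A u *ᵥ x) ∂μ = 0 := fun f => by
      filter_upwards [hT f, Lp.coeFn_zero ℂ 2 volume] with x h₁ h₂
      rw [← h₁, _root_.zero_apply, h₂, Pi.zero_apply]
    filter_upwards [adjoint_hausdorff_ae_eq_zero hA hdet hint hT0 g, Lp.coeFn_zero ℂ 2 volume]
      with x h₁ h₂
    rw [h₁, map_zero, _root_.zero_apply, h₂, Pi.zero_apply]

end HausdorffKernel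

/-- If the matrices `A(u)` pairwise commute, the Hausdorff operator on `L²(ℝⁿ)` is normal,
and its Hilbert-space adjoint is the Hausdorff operator with kernel `conj(Φ(v))|det A(v)|⁻¹`
and matrix family `A(v)⁻¹`. -/
theorem hausdorff_normal_and_adjoint {Ω : Type*} [MeasurableSpace Ω] (μ : Measure Ω)
    [SigmaFinite μ] (n : ℕ)
    (Φ : Ω → ℂ) (A : Ω → Matrix (Fin n) (Fin n) ℝ)
    (hA : ∀ i j, Measurable fun u => A u i j)
    (hdet : ∀ᵐ u ∂μ, Φ u ≠ 0 → IsUnit (A u).det)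
    (hint : Integrable (fun u => ‖Φ u‖ * |(A u).det| ^ (-((1 : ℝ) / 2))) μ)
    (hcomm : ∀ᵐ u ∂μ, ∀ᵐ v ∂μ, Φ u ≠ 0 → Φ v ≠ 0 → A u * A v = A v * A u)
    (T : Lp ℂ 2 (volume : Measure (Fin n → ℝ)) →L[ℂ] Lp ℂ 2 (volume : Measure (Fin n → ℝ)))
    (hT : ∀ f : Lp ℂ 2 (volume : Measure (Fin n → ℝ)),
      ∀ᵐ x : Fin n → ℝ ∂volume, T f x = ∫ u, Φ u * f ((A u).mulVec x) ∂μ) :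
    (∀ g : Lp ℂ 2 (volume : Measure (Fin n → ℝ)),
      ∀ᵐ x : Fin n → ℝ ∂volume, (ContinuousLinearMap.adjoint T) g x =
        ∫ v, conj (Φ v) * ((|(A v).det|⁻¹ : ℝ) : ℂ) * g ((A v)⁻¹.mulVec x) ∂μ) ∧
    T ∘L ContinuousLinearMap.adjoint T = ContinuousLinearMap.adjoint T ∘L T := by
  classical
  set B : Ω → Matrix (Fin n) (Fin n) ℝ := fun u => if (A u).det = 0 then 1 else A u with hB
  have hBdet : ∀ u, (B u).det ≠ 0 := fun u => by
    simp only [hB]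
    split_ifs with h
    · simp
    · exact h
  have hBA : ∀ i j, Measurable fun u => B u i j := fun i j => by
    have h : (fun u => B u i j) =
        fun u => if (A u).det = 0 then (1 : Matrix (Fin n) (Fin n) ℝ) i j else A u i j := by
      funext u
      simp only [hB]
      split_ifs <;> rfl
    rw [h]
    exact Measurable.ite ((measurable_matrix_det hA) (measurableSet_singleton 0))
      measurable_const (hA i j)
  have heq : ∀ᵐ u ∂μ, Φ u = 0 ∨ B u = A u := hdet.mono fun u hu => by
    by_cases hΦ : Φ u = 0
    · exact Or.inl hΦ
    · exact Or.inr (if_neg (hu hΦ).ne_zero)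
  have hBint : Integrable (fun u => ‖Φ u‖ * |(B u).det| ^ (-((1 : ℝ) / 2))) μ :=
    hint.congr (heq.mono fun u hu => by rcases hu with hu | hu <;> simp [hu])
  have hBcomm : ∀ᵐ u ∂μ, ∀ᵐ v ∂μ, Φ u ≠ 0 → Φ v ≠ 0 → B u * B v = B v * B u := by
    filter_upwards [hcomm, heq] with u hu hBu
    filter_upwards [hu, heq] with v hv hBv hΦu hΦv
    rw [hBu.resolve_left hΦu, hBv.resolve_left hΦv, hv hΦu hΦv]
  have hBT : ∀ f : Lp ℂ 2 (volume : Measure (Fin n → ℝ)),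
      ∀ᵐ x : Fin n → ℝ ∂volume, T f x = ∫ u, Φ u * f (B u *ᵥ x) ∂μ := fun f =>
    (hT f).mono fun x hx => hx.trans (integral_congr_ae (heq.mono fun u hu => by
      rcases hu with hu | hu <;> simp [hu]))
  obtain ⟨hadj, hnormal⟩ :=
    hausdorff_normal_and_adjoint_of_det_ne_zero hBA hBdet hBint hBcomm hBT
  exact ⟨fun g => (hadj g).mono fun x hx => hx.trans (integral_congr_ae (heq.mono fun u hu => by
    rcases hu with hu | hu <;> simp [hu])), hnormal⟩
end

section
/- Suppose there exist an orthogonal n×n matrix C and μ-measurable functions a_1, …, a_n : Ω → (0,∞) such that A(u) = C⁻¹ · diag(a_1(u),…,a_n(u)) · C for μ-a.e. u in the support of Φ, and that u ↦ |Φ(u)| · (a_1(u)⋯a_n(u))^{-1/2} is μ-integrable. Let T be a continuous linear operator on L²(ℝⁿ; ℂ) such that for every f ∈ L², (Tf)(x) = ∫_Ω Φ(u) f(A(u)x) dμ(u) for a.e. x. Then T is normal and there exists a linear isometric isomorphism V from L²(ℝⁿ; ℂ) onto L²(ℝⁿ; ℂ^{2^n}) such that for every f ∈ L²(ℝⁿ;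 ℂ), V(Tf)(s) = φ(s) • (Vf)(s) for a.e. s ∈ ℝⁿ, where φ(s) = ∫_Ω Φ(u) ∏_{j=1}^n a_j(u)^{-1/2 - i s_j} dμ(u) is the symbol of T. -/
open MeasureTheory Complex Filter Matrix
open scoped ENNReal ComplexConjugate

noncomputable section

namespace HausdorffOperator

variable {n : ℕ}

/-- The sign `1` or `-1` encoded by a Boolean. -/
def boolSign (b : Bool) : ℝ := if b then 1 else -1

/-- The exponential chart `t ↦ (±exp (2πt_j))_j` of the open orthant with sign pattern `σ`. -/
def orthantExp (σ : Fin n → Bool) (t : Fin n → ℝ) : Fin n → ℝ :=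
  fun j => boolSign (σ j) * Real.exp (2 * Real.pi * t j)

/-- The Jacobian of `orthantExp σ`, which does not depend on `σ`. -/
def orthantJac (t : Fin n → ℝ) : ℝ := ∏ j, (2 * Real.pi * Real.exp (2 * Real.pi * t j))

/-- The logarithmic coordinates of a point, inverse to `orthantExp`. -/
def orthantLog (x : Fin n → ℝ) : Fin n → ℝ := fun j => Real.log (x j) / (2 * Real.pi)

/-- The sign pattern of a point. -/
def orthantSign (x : Fin n → ℝ) : Fin n → Bool := fun j => decide (0 < x j)

lemma orthantJac_pos (t : Fin n → ℝ) : 0 < orthantJac t :=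
  Finset.prod_pos fun j _ => by positivity

lemma continuous_orthantJac : Continuous (orthantJac (n := n)) := by
  unfold orthantJac; fun_prop

lemma continuous_orthantExp (σ : Fin n → Bool) : Continuous (orthantExp σ) := by
  unfold orthantExp; fun_prop

lemma measurable_orthantLog : Measurable (orthantLog (n := n)) := by
  unfold orthantLog; fun_prop

lemma measurable_orthantSign : Measurable (orthantSign (n := n)) := by
  refine measurable_pi_lambda _ fun j => ?_
  refine measurable_to_bool ?_
  have : (fun x : Fin n → ℝ => orthantSign x j) ⁻¹' {true} = {x | 0 < x j} := by
    ext x; simp [orthantSign]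
  rw [this]
  exact measurableSet_lt measurable_const (measurable_pi_apply j)

lemma orthantSign_orthantExp (σ : Fin n → Bool) (t : Fin n → ℝ) :
    orthantSign (orthantExp σ t) = σ := by
  funext j
  have := Real.exp_pos (2 * Real.pi * t j)
  cases h : σ j <;> simp [orthantSign, orthantExp, boolSign, h, this, this.le]

lemma orthantLog_orthantExp (σ : Fin n → Bool) (t : Fin n → ℝ) :
    orthantLog (orthantExp σ t) = t := by
  funext j
  have : Real.pi ≠ 0 := Real.pi_ne_zero
  cases h : σ j <;> simp [orthantLog, orthantExp, boolSign, h]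

lemma orthantExp_orthantLog {x : Fin n → ℝ} (hx : ∀ j, x j ≠ 0) :
    orthantExp (orthantSign x) (orthantLog x) = x := by
  funext j
  have hpi : Real.pi ≠ 0 := Real.pi_ne_zero
  have h1 : 2 * Real.pi * (Real.log (x j) / (2 * Real.pi)) = Real.log (x j) := by field_simp
  simp only [orthantExp, orthantLog, h1, Real.exp_log_eq_abs (hx j), orthantSign, boolSign]
  rcases lt_or_gt_of_ne (hx j) with h | h
  · simp [h.not_gt, abs_of_neg h]
  · simp [h, abs_of_pos h]

lemma range_orthantExp (σ : Fin n → Bool) :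
    orthantExp σ '' Set.univ = {x | (∀ j, x j ≠ 0) ∧ orthantSign x = σ} := by
  ext x
  constructor
  · rintro ⟨t, -, rfl⟩
    refine ⟨fun j => ?_, orthantSign_orthantExp σ t⟩
    cases h : σ j <;> simp [orthantExp, boolSign, h]
  · rintro ⟨hx, rfl⟩
    exact ⟨orthantLog x, trivial, orthantExp_orthantLog hx⟩

lemma ae_forall_coord_ne_zero : ∀ᵐ x : Fin n → ℝ, ∀ j, x j ≠ 0 := by
  rw [ae_all_iff]
  intro j
  rw [ae_iff]
  simp only [not_not]
  exact Measure.pi_hyperplane (fun _ : Fin n => (volume : Measure ℝ)) j 0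

lemma hasFDerivAt_orthantExp (σ : Fin n → Bool) (t : Fin n → ℝ) :
    HasFDerivAt (orthantExp σ) (LinearMap.toContinuousLinearMap (Matrix.toLin' (Matrix.diagonal
      fun j => boolSign (σ j) * (2 * Real.pi * Real.exp (2 * Real.pi * t j))))) t := by
  rw [hasFDerivAt_pi']
  intro j
  have h1 : HasFDerivAt (fun t : Fin n → ℝ => t j)
      (ContinuousLinearMap.proj (R := ℝ) (φ := fun _ : Fin n => ℝ) j) t := hasFDerivAt_apply j t
  have h2 := ((h1.const_mul (2 * Real.pi)).exp).const_mul (boolSign (σ j))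
  refine h2.congr_fderiv ?_
  ext v
  simp [Matrix.mulVec_diagonal]
  ring

lemma lintegral_eq_sum_orthants {F : (Fin n → ℝ) → ℝ≥0∞} :
    ∫⁻ x, F x = ∑ σ : Fin n → Bool, ∫⁻ t, ENNReal.ofReal (orthantJac t) * F (orthantExp σ t) := by
  have hms : ∀ σ : Fin n → Bool,
      MeasurableSet {x : Fin n → ℝ | (∀ j, x j ≠ 0) ∧ orthantSign x = σ} := fun σ => by
    refine MeasurableSet.inter ?_ (measurable_orthantSign (measurableSet_singleton σ))
    have : {x : Fin n → ℝ | ∀ j, x j ≠ 0} = ⋂ j, {x | x j ≠ 0} := by ext; simp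
    change MeasurableSet {x : Fin n → ℝ | ∀ j, x j ≠ 0}
    rw [this]
    exact MeasurableSet.iInter fun j => (measurableSet_eq_fun (measurable_pi_apply j)
      measurable_const).compl
  have hdisj : Pairwise (Function.onFun Disjoint
      fun σ : Fin n → Bool => {x : Fin n → ℝ | (∀ j, x j ≠ 0) ∧ orthantSign x = σ}) := by
    intro σ τ h
    rw [Function.onFun, Set.disjoint_left]
    rintro x ⟨-, rfl⟩ ⟨-, h'⟩
    exact h h'
  have huniv : (⋃ σ : Fin n → Bool, {x : Fin n → ℝ | (∀ j, x j ≠ 0) ∧ orthantSign x = σ})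
      =ᵐ[volume] Set.univ := by
    rw [eventuallyEq_univ]
    filter_upwards [ae_forall_coord_ne_zero] with x hx
    simpa using hx
  rw [← setLIntegral_univ, ← setLIntegral_congr huniv, lintegral_iUnion hms hdisj, tsum_fintype]
  refine Finset.sum_congr rfl fun σ _ => ?_
  rw [← range_orthantExp, lintegral_image_eq_lintegral_abs_det_fderiv_mul volume MeasurableSet.univ
    (fun t _ => (hasFDerivAt_orthantExp σ t).hasFDerivWithinAt)
    (Function.LeftInverse.injective (orthantLog_orthantExp σ)).injOn, setLIntegral_univ]
  refine lintegral_congr fun t => ?_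
  congr 2
  simp only [ContinuousLinearMap.det, LinearMap.coe_toContinuousLinearMap, LinearMap.det_toLin',
    Matrix.det_diagonal, Finset.abs_prod, abs_mul, orthantJac]
  refine Finset.prod_congr rfl fun j _ => ?_
  cases h : σ j <;> simp [boolSign, abs_of_pos Real.pi_pos]

/-- The chart of `ℝⁿ` obtained from `orthantExp σ` by the inverse of the orthogonal matrix `C`. -/
def rotatedExp (C : Matrix (Fin n) (Fin n) ℝ) (σ : Fin n → Bool)
    (t : EuclideanSpace ℝ (Fin n)) : Fin n → ℝ :=
  C⁻¹.mulVec (orthantExp σ t.ofLp)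

lemma continuous_rotatedExp (C : Matrix (Fin n) (Fin n) ℝ) (σ : Fin n → Bool) :
    Continuous (rotatedExp C σ) :=
  Continuous.matrix_mulVec continuous_const
    ((continuous_orthantExp σ).comp (PiLp.continuous_ofLp 2 _))

lemma measurePreserving_mulVec {C : Matrix (Fin n) (Fin n) ℝ} (hC : |C.det| = 1) :
    MeasurePreserving (fun x : Fin n → ℝ => C.mulVec x) volume volume := by
  have h0 : C.det ≠ 0 := by
    intro h; simp [h] at hC
  refine ⟨by fun_prop, ?_⟩
  have := Real.map_matrix_volume_pi_eq_smul_volume_pi h0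
  rw [abs_inv, hC, inv_one, ENNReal.ofReal_one, one_smul] at this
  exact this

lemma abs_det_of_mul_transpose {C : Matrix (Fin n) (Fin n) ℝ} (hC : C * Cᵀ = 1) :
    |C.det| = 1 := by
  have := congrArg Matrix.det hC
  rw [Matrix.det_mul, Matrix.det_transpose, Matrix.det_one] at this
  rcases mul_self_eq_one_iff.1 this with h | h <;> simp [h]

lemma lintegral_eq_sum_rotatedExp {C : Matrix (Fin n) (Fin n) ℝ} (hC : C * Cᵀ = 1)
    {F : (Fin n → ℝ) → ℝ≥0∞} (hF : Measurable F) :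
    ∫⁻ x, F x = ∑ σ : Fin n → Bool, ∫⁻ t : EuclideanSpace ℝ (Fin n),
      ENNReal.ofReal (orthantJac t.ofLp) * F (rotatedExp C σ t) := by
  have hC' : |C⁻¹.det| = 1 := by
    rw [Matrix.det_nonsing_inv, Ring.inverse_eq_inv', abs_inv, abs_det_of_mul_transpose hC, inv_one]
  rw [← (measurePreserving_mulVec hC').lintegral_comp hF, lintegral_eq_sum_orthants]
  refine Finset.sum_congr rfl fun σ _ => ?_
  rw [← (PiLp.volume_preserving_ofLp (Fin n)).lintegral_comp]
  · rfl
  · refine Measurable.mul continuous_orthantJac.measurable.ennreal_ofReal (hF.comp ?_)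
    exact (Continuous.matrix_mulVec continuous_const (continuous_orthantExp σ)).measurable

lemma quasiMeasurePreserving_rotatedExp {C : Matrix (Fin n) (Fin n) ℝ} (hC : C * Cᵀ = 1)
    (σ : Fin n → Bool) :
    Measure.QuasiMeasurePreserving (rotatedExp C σ) volume volume := by
  refine ⟨(continuous_rotatedExp C σ).measurable, Measure.AbsolutelyContinuous.mk fun s hs h0 => ?_⟩
  rw [Measure.map_apply (continuous_rotatedExp C σ).measurable hs]
  have h := lintegral_eq_sum_rotatedExp hC (F := s.indicator 1) (measurable_one.indicator hs)
  rw [lintegral_indicator_one hs, h0, eq_comm, Finset.sum_eq_zero_iff] at h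
  have h1 := h σ (Finset.mem_univ σ)
  rw [lintegral_eq_zero_iff] at h1
  · refine measure_mono_null ?_ (ae_iff.1 h1)
    intro t ht
    have ht' : rotatedExp C σ t ∈ s := ht
    simp [ht', orthantJac_pos]
  · refine Measurable.mul ?_ ((measurable_one.indicator hs).comp
      (continuous_rotatedExp C σ).measurable)
    exact (continuous_orthantJac.comp (PiLp.continuous_ofLp 2 _)).measurable.ennreal_ofReal

lemma mul_inv_of_orthogonal {C : Matrix (Fin n) (Fin n) ℝ} (hC : C * Cᵀ = 1) : C * C⁻¹ = 1 := by
  apply Matrix.mul_nonsing_inv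
  rw [isUnit_iff_ne_zero]
  intro h
  simpa [h] using abs_det_of_mul_transpose hC

lemma mulVec_rotatedExp {C : Matrix (Fin n) (Fin n) ℝ} (hC : C * Cᵀ = 1)
    (σ : Fin n → Bool) (t : EuclideanSpace ℝ (Fin n)) :
    C.mulVec (rotatedExp C σ t) = orthantExp σ t.ofLp := by
  rw [rotatedExp, Matrix.mulVec_mulVec, mul_inv_of_orthogonal hC, Matrix.one_mulVec]

/-- The rescaled pullbacks of a function to logarithmic coordinates on all orthants, collected in
one vector-valued function. -/
def logPullback (C : Matrix (Fin n) (Fin n) ℝ) (e : (Fin n → Bool) ≃ Fin (2 ^ n))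
    (f : (Fin n → ℝ) → ℂ) (t : EuclideanSpace ℝ (Fin n)) : EuclideanSpace ℂ (Fin (2 ^ n)) :=
  WithLp.toLp 2 fun k => (Real.sqrt (orthantJac t.ofLp) : ℂ) * f (rotatedExp C (e.symm k) t)

lemma enorm_logPullback_sq (C : Matrix (Fin n) (Fin n) ℝ) (e : (Fin n → Bool) ≃ Fin (2 ^ n))
    (f : (Fin n → ℝ) → ℂ) (t : EuclideanSpace ℝ (Fin n)) :
    ‖logPullback C e f t‖ₑ ^ 2 = ∑ σ : Fin n → Bool,
      ENNReal.ofReal (orthantJac t.ofLp) * ‖f (rotatedExp C σ t)‖ₑ ^ 2 := by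
  rw [← ofReal_norm, ← ENNReal.ofReal_pow (norm_nonneg _), EuclideanSpace.norm_sq_eq,
    ENNReal.ofReal_sum_of_nonneg fun _ _ => by positivity, ← e.symm.sum_comp]
  refine Finset.sum_congr rfl fun k _ => ?_
  rw [← ofReal_norm, ← ENNReal.ofReal_pow (norm_nonneg _),
    ← ENNReal.ofReal_mul (orthantJac_pos _).le]
  simp only [logPullback, norm_mul, mul_pow, Complex.norm_real, Real.norm_eq_abs, sq_abs,
    Real.sq_sqrt (orthantJac_pos _).le]

lemma measurable_logPullback (C : Matrix (Fin n) (Fin n) ℝ) (e : (Fin n → Bool) ≃ Fin (2 ^ n))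
    {f : (Fin n → ℝ) → ℂ} (hf : Measurable f) : Measurable (logPullback C e f) := by
  refine (PiLp.continuous_toLp 2 _).measurable.comp (measurable_pi_lambda _ fun k => ?_)
  refine Measurable.mul ?_ (hf.comp (continuous_rotatedExp C _).measurable)
  exact Complex.measurable_ofReal.comp
    (continuous_orthantJac.comp (PiLp.continuous_ofLp 2 _)).measurable.sqrt

lemma eLpNorm_logPullback {C : Matrix (Fin n) (Fin n) ℝ} (hC : C * Cᵀ = 1)
    (e : (Fin n → Bool) ≃ Fin (2 ^ n)) {f : (Fin n → ℝ) → ℂ} (hf : Measurable f) :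
    eLpNorm (logPullback C e f) 2 volume = eLpNorm f 2 volume := by
  rw [eLpNorm_eq_lintegral_rpow_enorm_toReal (by simp) (by simp),
    eLpNorm_eq_lintegral_rpow_enorm_toReal (by simp) (by simp)]
  congr 1
  simp only [ENNReal.toReal_ofNat, ENNReal.rpow_ofNat]
  rw [lintegral_eq_sum_rotatedExp hC (hf.enorm.pow_const 2)]
  simp only [enorm_logPullback_sq]
  rw [lintegral_finsetSum]
  intro σ _
  refine Measurable.mul
    (continuous_orthantJac.comp (PiLp.continuous_ofLp 2 _)).measurable.ennreal_ofReal ?_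
  exact (hf.comp (continuous_rotatedExp C σ).measurable).enorm.pow_const 2

lemma logPullback_congr {C : Matrix (Fin n) (Fin n) ℝ} (hC : C * Cᵀ = 1)
    (e : (Fin n → Bool) ≃ Fin (2 ^ n)) {f g : (Fin n → ℝ) → ℂ} (h : f =ᵐ[volume] g) :
    logPullback C e f =ᵐ[volume] logPullback C e g := by
  have : ∀ᵐ t, ∀ σ : Fin n → Bool, f (rotatedExp C σ t) = g (rotatedExp C σ t) :=
    ae_all_iff.2 fun σ => (quasiMeasurePreserving_rotatedExp hC σ).ae h
  filter_upwards [this] with t ht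
  simp only [logPullback, ht]

lemma memLp_logPullback {C : Matrix (Fin n) (Fin n) ℝ} (hC : C * Cᵀ = 1)
    (e : (Fin n → Bool) ≃ Fin (2 ^ n)) (f : Lp ℂ 2 (volume : Measure (Fin n → ℝ))) :
    MemLp (logPullback C e f) 2 volume := by
  have hf := (Lp.stronglyMeasurable f).measurable
  refine ⟨(measurable_logPullback C e hf).aestronglyMeasurable, ?_⟩
  rw [eLpNorm_logPullback hC e hf]
  exact Lp.eLpNorm_lt_top f

/-- `logPullback` as a linear isometry of `L²` spaces. -/
def logPullbackₗᵢ {C : Matrix (Fin n) (Fin n) ℝ} (hC : C * Cᵀ = 1)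
    (e : (Fin n → Bool) ≃ Fin (2 ^ n)) :
    Lp ℂ 2 (volume : Measure (Fin n → ℝ)) →ₗᵢ[ℂ]
      Lp (EuclideanSpace ℂ (Fin (2 ^ n))) 2 (volume : Measure (EuclideanSpace ℝ (Fin n))) where
  toFun f := (memLp_logPullback hC e f).toLp _
  map_add' f g := by
    rw [← MemLp.toLp_add]
    refine MemLp.toLp_congr _ _ ((logPullback_congr hC e (Lp.coeFn_add f g)).trans ?_)
    refine .of_forall fun t => ?_
    ext k
    simp [logPullback, mul_add]
  map_smul' c f := by
    rw [RingHom.id_apply, ← MemLp.toLp_const_smul]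
    refine MemLp.toLp_congr _ _ ((logPullback_congr hC e (Lp.coeFn_smul c f)).trans ?_)
    refine .of_forall fun t => ?_
    ext k
    simp [logPullback, mul_left_comm]
  norm_map' f := by
    change ‖(memLp_logPullback hC e f).toLp _‖ = _
    rw [Lp.norm_toLp, eLpNorm_logPullback hC e (Lp.stronglyMeasurable f).measurable, Lp.norm_def]

lemma coeFn_logPullbackₗᵢ {C : Matrix (Fin n) (Fin n) ℝ} (hC : C * Cᵀ = 1)
    (e : (Fin n → Bool) ≃ Fin (2 ^ n)) (f : Lp ℂ 2 (volume : Measure (Fin n → ℝ))) :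
    logPullbackₗᵢ hC e f =ᵐ[volume] logPullback C e f :=
  (memLp_logPullback hC e f).coeFn_toLp

/-- The function whose pullback to logarithmic coordinates is the given one. -/
def logPushforward (C : Matrix (Fin n) (Fin n) ℝ) (e : (Fin n → Bool) ≃ Fin (2 ^ n))
    (g : EuclideanSpace ℝ (Fin n) → EuclideanSpace ℂ (Fin (2 ^ n))) (x : Fin n → ℝ) : ℂ :=
  ((Real.sqrt (orthantJac (orthantLog (C.mulVec x))))⁻¹ : ℂ) *
    g (WithLp.toLp 2 (orthantLog (C.mulVec x))) (e (orthantSign (C.mulVec x)))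

lemma measurable_logPushforward (C : Matrix (Fin n) (Fin n) ℝ) (e : (Fin n → Bool) ≃ Fin (2 ^ n))
    {g : EuclideanSpace ℝ (Fin n) → EuclideanSpace ℂ (Fin (2 ^ n))} (hg : Measurable g) :
    Measurable (logPushforward C e g) := by
  have hmC : Measurable fun x : Fin n → ℝ => C.mulVec x := by fun_prop
  have hl := measurable_orthantLog.comp hmC
  refine Measurable.mul ?_ ?_
  · exact (Complex.measurable_ofReal.comp (continuous_orthantJac.measurable.comp hl).sqrt).inv
  · have h1 : Measurable fun p : EuclideanSpace ℝ (Fin n) × (Fin n → Bool) => g p.1 (e p.2) := by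
      refine measurable_from_prod_countable_left fun σ => ?_
      exact (measurable_pi_apply (e σ)).comp ((PiLp.continuous_ofLp 2 _).measurable.comp hg)
    exact h1.comp (((PiLp.continuous_toLp 2 _).measurable.comp hl).prodMk
      (measurable_orthantSign.comp hmC))

lemma logPullback_logPushforward {C : Matrix (Fin n) (Fin n) ℝ} (hC : C * Cᵀ = 1)
    (e : (Fin n → Bool) ≃ Fin (2 ^ n))
    (g : EuclideanSpace ℝ (Fin n) → EuclideanSpace ℂ (Fin (2 ^ n))) :
    logPullback C e (logPushforward C e g) = g := by
  funext t
  ext k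
  have h : (Real.sqrt (orthantJac t.ofLp) : ℂ) ≠ 0 := by
    exact_mod_cast (Real.sqrt_pos.2 (orthantJac_pos _)).ne'
  simp [logPullback, logPushforward, mulVec_rotatedExp hC, orthantLog_orthantExp,
    orthantSign_orthantExp, h]

lemma logPullbackₗᵢ_surjective {C : Matrix (Fin n) (Fin n) ℝ} (hC : C * Cᵀ = 1)
    (e : (Fin n → Bool) ≃ Fin (2 ^ n)) : Function.Surjective (logPullbackₗᵢ hC e) := by
  intro g
  have hm := measurable_logPushforward C e (Lp.stronglyMeasurable g).measurable
  have hmem : MemLp (logPushforward C e g) 2 volume := by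
    refine ⟨hm.aestronglyMeasurable, ?_⟩
    rw [← eLpNorm_logPullback hC e hm, logPullback_logPushforward hC]
    exact Lp.eLpNorm_lt_top g
  refine ⟨hmem.toLp _, Lp.ext ?_⟩
  refine (coeFn_logPullbackₗᵢ hC e _).trans ((logPullback_congr hC e hmem.coeFn_toLp).trans ?_)
  rw [logPullback_logPushforward hC]

open FourierTransform in
/-- Translation becomes modulation under the inverse Fourier transform on `L²`. -/
lemma fourierInv_compMeasurePreserving_add {E F : Type*} [NormedAddCommGroup E]
    [InnerProductSpace ℝ E] [FiniteDimensional ℝ E] [MeasurableSpace E] [BorelSpace E]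
    [NormedAddCommGroup F] [InnerProductSpace ℂ F] [CompleteSpace F]
    (h : E) (g : Lp F 2 (volume : Measure E)) :
    (𝓕⁻ (Lp.compMeasurePreserving (· + h) (measurePreserving_add_right volume h) g) :
      Lp F 2 (volume : Measure E)) =ᵐ[volume] fun s => Complex.exp (-(2 * Real.pi * inner ℝ h s : ℝ) * I) •
        (𝓕⁻ g : Lp F 2 (volume : Measure E)) s := by
  have hm : MemLp (fun s : E => Complex.exp (-(2 * Real.pi * inner ℝ h s : ℝ) * I)) ∞ volume := by
    refine memLp_top_of_bound (Continuous.aestronglyMeasurable (by fun_prop)) 1 (.of_forall fun s => ?_)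
    rw [← ofReal_neg, Complex.norm_exp_ofReal_mul_I]
  have key : 𝓕⁻ (Lp.compMeasurePreserving (· + h) (measurePreserving_add_right volume h) g) =
      (ContinuousLinearMap.lsmul ℂ ℂ (E := F)).holderL volume ∞ 2 2 (hm.toLp _) (𝓕⁻ g) := by
    refine DenseRange.induction_on (p := fun g : Lp F 2 (volume : Measure E) =>
      𝓕⁻ (Lp.compMeasurePreserving (· + h) (measurePreserving_add_right volume h) g) =
      (ContinuousLinearMap.lsmul ℂ ℂ (E := F)).holderL volume ∞ 2 2 (hm.toLp _) (𝓕⁻ g))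
      (SchwartzMap.denseRange_toLpCLM (p := 2) ENNReal.ofNat_ne_top) g ?_ ?_
    · refine isClosed_eq ?_ ?_
      · exact (Lp.fourierTransformₗᵢ E F).symm.continuous.comp
          (Lp.isometry_compMeasurePreserving _).continuous
      · exact (ContinuousLinearMap.continuous _).comp
          (Lp.fourierTransformₗᵢ E F).symm.continuous
    · intro f
      have h1 : Lp.compMeasurePreserving (· + h) (measurePreserving_add_right volume h)
          (SchwartzMap.toLpCLM ℝ F 2 volume f) = (f.compSubConstCLM ℂ (-h)).toLp 2 := by
        rw [SchwartzMap.toLpCLM_apply, SchwartzMap.toLp, Lp.toLp_compMeasurePreserving]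
        refine MemLp.toLp_congr _ _ (.of_forall fun x => ?_)
        simp
      rw [h1, SchwartzMap.toLpCLM_apply, SchwartzMap.toLp_fourierInv_eq,
        SchwartzMap.toLp_fourierInv_eq]
      refine Lp.ext ?_
      filter_upwards [(𝓕⁻ (f.compSubConstCLM ℂ (-h))).coeFn_toLp 2 volume,
        (𝓕⁻ f).coeFn_toLp 2 volume, hm.coeFn_toLp,
        ContinuousLinearMap.coeFn_holder (r := 2) (ContinuousLinearMap.lsmul ℂ ℂ (E := F))
          (hm.toLp _) ((𝓕⁻ f).toLp 2 volume)] with s h1 h2 h3 h4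
      rw [ContinuousLinearMap.holderL_apply_apply, h4, h1, h2, h3,
        SchwartzMap.fourierInv_coe, SchwartzMap.fourierInv_coe]
      have h5 : ((f.compSubConstCLM ℂ (-h) : SchwartzMap E F) : E → F) = f ∘ fun v => v + h := by
        funext v; simp
      rw [h5]
      have h6 := congrFun (VectorFourier.fourierIntegral_comp_add_right Real.fourierChar
        (volume : Measure E) (-innerₗ E) f h) s
      refine h6.trans ?_
      rw [Circle.smul_def, Real.fourierChar_apply]
      simp only [LinearMap.neg_apply, innerₗ_apply_apply, ContinuousLinearMap.lsmul_apply]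
      congr 2
      push_cast
      ring
  rw [key]
  filter_upwards [hm.coeFn_toLp,
    ContinuousLinearMap.coeFn_holder (r := 2) (ContinuousLinearMap.lsmul ℂ ℂ (E := F))
      (hm.toLp _) (𝓕⁻ g)] with s h3 h4
  rw [ContinuousLinearMap.holderL_apply_apply, h4, h3, ContinuousLinearMap.lsmul_apply]

/-- Square integrable functions on `EuclideanSpace ℝ (Fin n)`, regarded on `Fin n → ℝ`. -/
def euclideanToPi (F : Type*) [NormedAddCommGroup F] [NormedSpace ℂ F] (n : ℕ) :
    Lp F 2 (volume : Measure (EuclideanSpace ℝ (Fin n))) ≃ₗᵢ[ℂ]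
      Lp F 2 (volume : Measure (Fin n → ℝ)) :=
  LinearIsometryEquiv.ofSurjective
    (Lp.compMeasurePreservingₗᵢ ℂ (WithLp.toLp 2) (PiLp.volume_preserving_toLp (Fin n))) <| by
    intro g
    refine ⟨Lp.compMeasurePreserving WithLp.ofLp (PiLp.volume_preserving_ofLp (Fin n)) g,
      Lp.ext ?_⟩
    refine (Lp.coeFn_compMeasurePreserving _ (PiLp.volume_preserving_toLp (Fin n))).trans ?_
    exact (PiLp.volume_preserving_toLp (Fin n)).quasiMeasurePreserving.ae
      (Lp.coeFn_compMeasurePreserving g (PiLp.volume_preserving_ofLp (Fin n)))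

lemma coeFn_euclideanToPi {F : Type*} [NormedAddCommGroup F] [NormedSpace ℂ F]
    (g : Lp F 2 (volume : Measure (EuclideanSpace ℝ (Fin n)))) :
    euclideanToPi F n g =ᵐ[volume] fun s => g (WithLp.toLp 2 s) :=
  Lp.coeFn_compMeasurePreserving g (PiLp.volume_preserving_toLp (Fin n))

/-- The unitary operator diagonalizing all dilations `f ↦ f ∘ (C⁻¹ diag(b) C)` with `b > 0`. -/
def diagonalizer {C : Matrix (Fin n) (Fin n) ℝ} (hC : C * Cᵀ = 1)
    (e : (Fin n → Bool) ≃ Fin (2 ^ n)) :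
    Lp ℂ 2 (volume : Measure (Fin n → ℝ)) ≃ₗᵢ[ℂ]
      Lp (EuclideanSpace ℂ (Fin (2 ^ n))) 2 (volume : Measure (Fin n → ℝ)) :=
  ((LinearIsometryEquiv.ofSurjective (logPullbackₗᵢ hC e) (logPullbackₗᵢ_surjective hC e)).trans
    (Lp.fourierTransformₗᵢ (EuclideanSpace ℝ (Fin n))
      (EuclideanSpace ℂ (Fin (2 ^ n)))).symm).trans (euclideanToPi _ n)

/-- The factor by which the dilation with eigenvalues `b` acts at frequency `s`. -/
def dilationSymbol (b s : Fin n → ℝ) : ℂ :=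
  ∏ j, (b j : ℂ) ^ (-(1 / 2 : ℂ) - Complex.I * (s j : ℂ))

lemma orthantJac_add_log {b : Fin n → ℝ} (hb : ∀ j, 0 < b j) (t : Fin n → ℝ) :
    orthantJac (t + orthantLog b) = orthantJac t * ∏ j, b j := by
  simp only [orthantJac, ← Finset.prod_mul_distrib]
  refine Finset.prod_congr rfl fun j _ => ?_
  have hpi : Real.pi ≠ 0 := Real.pi_ne_zero
  have h1 : 2 * Real.pi * (t + orthantLog b) j = 2 * Real.pi * t j + Real.log (b j) := by
    simp only [Pi.add_apply, orthantLog]; field_simp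
  rw [h1, Real.exp_add, Real.exp_log (hb j)]
  ring

lemma mulVec_rotatedExp_dilation {C : Matrix (Fin n) (Fin n) ℝ} (hC : C * Cᵀ = 1)
    {b : Fin n → ℝ} (hb : ∀ j, 0 < b j) (σ : Fin n → Bool) (t : EuclideanSpace ℝ (Fin n)) :
    (C⁻¹ * Matrix.diagonal b * C).mulVec (rotatedExp C σ t) =
      rotatedExp C σ (t + WithLp.toLp 2 (orthantLog b)) := by
  rw [← Matrix.mulVec_mulVec, mulVec_rotatedExp hC, ← Matrix.mulVec_mulVec, rotatedExp]
  congr 1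
  funext j
  have hpi : Real.pi ≠ 0 := Real.pi_ne_zero
  have h1 : 2 * Real.pi * (t + WithLp.toLp 2 (orthantLog b)) j =
      2 * Real.pi * t j + Real.log (b j) := by
    simp only [PiLp.add_apply, orthantLog]; field_simp
  rw [Matrix.mulVec_diagonal, orthantExp, orthantExp, h1, Real.exp_add, Real.exp_log (hb j)]
  ring

lemma dilationSymbol_eq {b : Fin n → ℝ} (hb : ∀ j, 0 < b j) (s : Fin n → ℝ) :
    dilationSymbol b s = (Real.sqrt (∏ j, b j) : ℂ)⁻¹ * Complex.exp (-(2 * Real.pi *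
      inner ℝ (WithLp.toLp 2 (orthantLog b) : EuclideanSpace ℝ (Fin n)) (WithLp.toLp 2 s) : ℝ) * I)
      := by
  have hpi : Real.pi ≠ 0 := Real.pi_ne_zero
  have h1 : 2 * Real.pi * inner ℝ (WithLp.toLp 2 (orthantLog b) : EuclideanSpace ℝ (Fin n))
      (WithLp.toLp 2 s) = ∑ j, Real.log (b j) * s j := by
    rw [PiLp.inner_apply, Finset.mul_sum]
    refine Finset.sum_congr rfl fun j _ => ?_
    simp [orthantLog]; field_simp
  have h2 : Real.sqrt (∏ j, b j) = ∏ j, Real.exp (Real.log (b j) / 2) := by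
    rw [Real.sqrt_eq_rpow, ← Real.finsetProd_rpow _ _ fun j _ => (hb j).le]
    refine Finset.prod_congr rfl fun j _ => ?_
    rw [Real.rpow_def_of_pos (hb j)]; ring_nf
  rw [h1, h2]
  push_cast
  rw [← Complex.exp_sum, ← Complex.exp_neg, ← Complex.exp_add, dilationSymbol]
  have h3 : ∀ j, (b j : ℂ) ^ (-(1 / 2 : ℂ) - Complex.I * (s j : ℂ)) =
      Complex.exp (-((Real.log (b j) : ℂ) / 2) - Real.log (b j) * s j * I) := fun j => by
    rw [Complex.cpow_def_of_ne_zero (by exact_mod_cast (hb j).ne'), ← Complex.ofReal_log (hb j).le]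
    ring_nf
  simp only [h3]
  rw [← Complex.exp_sum, Finset.sum_sub_distrib, Finset.sum_neg_distrib, ← Finset.sum_mul, ← Finset.sum_div]
  congr 1
  ring

lemma diagonalizer_dilation {C : Matrix (Fin n) (Fin n) ℝ} (hC : C * Cᵀ = 1)
    (e : (Fin n → Bool) ≃ Fin (2 ^ n)) {b : Fin n → ℝ} (hb : ∀ j, 0 < b j)
    {f g : Lp ℂ 2 (volume : Measure (Fin n → ℝ))}
    (hg : g =ᵐ[volume] fun x => f ((C⁻¹ * Matrix.diagonal b * C).mulVec x)) :
    diagonalizer hC e g =ᵐ[volume] fun s => dilationSymbol b s • diagonalizer hC e f s := by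
  set h : EuclideanSpace ℝ (Fin n) := WithLp.toLp 2 (orthantLog b) with hh
  set c : ℂ := (Real.sqrt (∏ j, b j) : ℂ)⁻¹ with hc
  have hbpos : 0 < ∏ j, b j := Finset.prod_pos fun j _ => hb j
  have hU : logPullbackₗᵢ hC e g = c • Lp.compMeasurePreserving (· + h)
      (measurePreserving_add_right volume h) (logPullbackₗᵢ hC e f) := by
    refine Lp.ext ?_
    filter_upwards [coeFn_logPullbackₗᵢ hC e g, logPullback_congr hC e hg,
      Lp.coeFn_smul c (Lp.compMeasurePreserving (· + h)
        (measurePreserving_add_right volume h) (logPullbackₗᵢ hC e f)),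
      Lp.coeFn_compMeasurePreserving (logPullbackₗᵢ hC e f) (measurePreserving_add_right volume h),
      (measurePreserving_add_right volume h).quasiMeasurePreserving.ae
        (coeFn_logPullbackₗᵢ hC e f)] with t h1 h2 h3 h4 h5
    rw [h1, h2, h3, Pi.smul_apply, h4, Function.comp_apply, h5]
    ext k
    have h6 : orthantJac (t + h).ofLp = orthantJac t.ofLp * ∏ j, b j :=
      orthantJac_add_log hb t.ofLp
    have h7 : (Real.sqrt (∏ j, b j) : ℂ) ≠ 0 := by exact_mod_cast (Real.sqrt_pos.2 hbpos).ne'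
    simp only [logPullback, mulVec_rotatedExp_dilation hC hb, PiLp.smul_apply, smul_eq_mul, h6,
      Real.sqrt_mul (orthantJac_pos _).le, Complex.ofReal_mul, hc, ← hh]
    field_simp
  have hF : diagonalizer hC e g = c • euclideanToPi _ n ((Lp.fourierTransformₗᵢ _ _).symm
      (Lp.compMeasurePreserving (· + h) (measurePreserving_add_right volume h)
        (logPullbackₗᵢ hC e f))) := by
    rw [← map_smul, ← map_smul, ← hU]; rfl
  rw [hF]
  filter_upwards [Lp.coeFn_smul c (euclideanToPi _ n ((Lp.fourierTransformₗᵢ _ _).symm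
      (Lp.compMeasurePreserving (· + h) (measurePreserving_add_right volume h)
        (logPullbackₗᵢ hC e f)))), coeFn_euclideanToPi ((Lp.fourierTransformₗᵢ _ _).symm
      (Lp.compMeasurePreserving (· + h) (measurePreserving_add_right volume h)
        (logPullbackₗᵢ hC e f))),
    coeFn_euclideanToPi ((Lp.fourierTransformₗᵢ _ _).symm (logPullbackₗᵢ hC e f)),
    (PiLp.volume_preserving_toLp (Fin n)).quasiMeasurePreserving.ae
      (fourierInv_compMeasurePreserving_add h (logPullbackₗᵢ hC e f))] with s h1 h2 h3 h4
  rw [h1, Pi.smul_apply, h2]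
  refine (congrArg (c • ·) h4).trans ?_
  rw [dilationSymbol_eq hb, mul_smul]
  congr 2
  exact h3.symm

lemma det_dilation {C : Matrix (Fin n) (Fin n) ℝ} (hC : C * Cᵀ = 1) (b : Fin n → ℝ) :
    (C⁻¹ * Matrix.diagonal b * C).det = ∏ j, b j := by
  have h : C⁻¹.det * C.det = 1 := by
    rw [← Matrix.det_mul, mul_eq_one_comm.1 (mul_inv_of_orthogonal hC), Matrix.det_one]
  rw [Matrix.det_mul, Matrix.det_mul, Matrix.det_diagonal, mul_right_comm, h, one_mul]

lemma map_dilation {C : Matrix (Fin n) (Fin n) ℝ} (hC : C * Cᵀ = 1) {b : Fin n → ℝ}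
    (hb : ∀ j, 0 < b j) :
    Measure.map (fun x => (C⁻¹ * Matrix.diagonal b * C).mulVec x) volume =
      ENNReal.ofReal (∏ j, b j)⁻¹ • (volume : Measure (Fin n → ℝ)) := by
  have hpos : 0 < ∏ j, b j := Finset.prod_pos fun j _ => hb j
  have h := Real.map_matrix_volume_pi_eq_smul_volume_pi
    (M := C⁻¹ * Matrix.diagonal b * C) (by rw [det_dilation hC]; exact hpos.ne')
  rw [det_dilation hC, abs_of_pos (inv_pos.2 hpos)] at h
  exact h

lemma quasiMeasurePreserving_dilation {C : Matrix (Fin n) (Fin n) ℝ} (hC : C * Cᵀ = 1)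
    {b : Fin n → ℝ} (hb : ∀ j, 0 < b j) :
    Measure.QuasiMeasurePreserving (fun x => (C⁻¹ * Matrix.diagonal b * C).mulVec x)
      volume volume :=
  ⟨by fun_prop, by rw [map_dilation hC hb]; exact Measure.smul_absolutelyContinuous⟩

lemma exists_dilation {C : Matrix (Fin n) (Fin n) ℝ} (hC : C * Cᵀ = 1) {b : Fin n → ℝ}
    (hb : ∀ j, 0 < b j) (f : Lp ℂ 2 (volume : Measure (Fin n → ℝ))) :
    ∃ g : Lp ℂ 2 (volume : Measure (Fin n → ℝ)),
      (g =ᵐ[volume] fun x => f ((C⁻¹ * Matrix.diagonal b * C).mulVec x)) ∧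
      ‖g‖ = (∏ j, b j) ^ (-((1 : ℝ) / 2)) * ‖f‖ := by
  have hpos : 0 < ∏ j, b j := Finset.prod_pos fun j _ => hb j
  have hm : Measurable fun x => (C⁻¹ * Matrix.diagonal b * C).mulVec x := by fun_prop
  have hf := (Lp.stronglyMeasurable f)
  have hnorm : eLpNorm (fun x => f ((C⁻¹ * Matrix.diagonal b * C).mulVec x)) 2 volume =
      ENNReal.ofReal ((∏ j, b j) ^ (-((1 : ℝ) / 2))) * eLpNorm f 2 volume := by
    have h1 := eLpNorm_map_measure (p := 2) (μ := volume) (g := f)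
      hf.aestronglyMeasurable hm.aemeasurable
    rw [map_dilation hC hb, eLpNorm_smul_measure_of_ne_top (by simp)] at h1
    refine h1.symm.trans ?_
    rw [smul_eq_mul, ENNReal.ofReal_rpow_of_pos (inv_pos.2 hpos), Real.inv_rpow hpos.le,
      ← Real.rpow_neg hpos.le]
    simp
  have hmem : MemLp (fun x => f ((C⁻¹ * Matrix.diagonal b * C).mulVec x)) 2 volume := by
    refine ⟨(hf.comp_measurable hm).aestronglyMeasurable, ?_⟩
    rw [hnorm]
    exact ENNReal.mul_lt_top ENNReal.ofReal_lt_top (Lp.eLpNorm_lt_top f)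
  refine ⟨hmem.toLp _, hmem.coeFn_toLp, ?_⟩
  rw [Lp.norm_toLp, hnorm, ENNReal.toReal_mul, ENNReal.toReal_ofReal (by positivity), Lp.norm_def]

lemma integral_norm_inner_le {α : Type*} [MeasurableSpace α] {ν : Measure α}
    (k g : Lp ℂ 2 ν) : ∫ x, ‖inner ℂ (k x) (g x)‖ ∂ν ≤ ‖k‖ * ‖g‖ := by
  have h := Lp.norm_smul_le (r := 1) k g
  rw [L1.norm_eq_integral_norm] at h
  refine le_trans (le_of_eq (integral_congr_ae ?_)) h
  filter_upwards [Lp.coeFn_lpSMul (r := 1) k g] with x hx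
  rw [hx]
  simp [mul_comm]

lemma norm_dilationSymbol {b : Fin n → ℝ} (hb : ∀ j, 0 < b j) (s : Fin n → ℝ) :
    ‖dilationSymbol b s‖ = (∏ j, b j) ^ (-((1 : ℝ) / 2)) := by
  have hpos : 0 < ∏ j, b j := Finset.prod_pos fun j _ => hb j
  rw [dilationSymbol_eq hb, norm_mul, ← ofReal_neg, Complex.norm_exp_ofReal_mul_I, mul_one,
    norm_inv, Complex.norm_real, Real.norm_of_nonneg (Real.sqrt_nonneg _), Real.sqrt_eq_rpow,
    Real.rpow_neg hpos.le]

section Symbol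

variable {Ω : Type*} [MeasurableSpace Ω] {μ : Measure Ω}

/-- The symbol of the Hausdorff operator with kernel `Φ` and eigenvalues `a`. -/
def hausdorffSymbol (μ : Measure Ω) (Φ : Ω → ℂ) (a : Fin n → Ω → ℝ) (s : Fin n → ℝ) : ℂ :=
  ∫ u, Φ u * dilationSymbol (fun j => a j u) s ∂μ

lemma measurable_dilationSymbol {a : Fin n → Ω → ℝ} (ha : ∀ j, Measurable (a j)) :
    Measurable fun p : Ω × (Fin n → ℝ) => dilationSymbol (fun j => a j p.1) p.2 := by
  unfold dilationSymbol
  refine Finset.measurable_fun_prod _ fun j _ => ?_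
  refine Measurable.pow ?_ ?_
  · exact Complex.measurable_ofReal.comp ((ha j).comp measurable_fst)
  · exact measurable_const.sub (measurable_const.mul
      (Complex.measurable_ofReal.comp ((measurable_pi_apply j).comp measurable_snd)))

lemma measurable_dilation {a : Fin n → Ω → ℝ} (ha : ∀ j, Measurable (a j))
    (C : Matrix (Fin n) (Fin n) ℝ) :
    Measurable fun p : Ω × (Fin n → ℝ) =>
      (C⁻¹ * Matrix.diagonal (fun j => a j p.1) * C).mulVec p.2 := by
  have hmC : Measurable fun x : Fin n → ℝ => C.mulVec x := by fun_prop
  have hmC' : Measurable fun x : Fin n → ℝ => C⁻¹.mulVec x := by fun_prop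
  simp only [← Matrix.mulVec_mulVec]
  refine hmC'.comp (measurable_pi_lambda _ fun j => ?_)
  simp only [Matrix.mulVec_diagonal]
  exact ((ha j).comp measurable_fst).mul
    ((measurable_pi_apply j).comp (hmC.comp measurable_snd))

lemma memLp_hausdorffSymbol [SigmaFinite μ] {Φ : Ω → ℂ} (hΦ : AEStronglyMeasurable Φ μ)
    {a : Fin n → Ω → ℝ} (ha : ∀ j, Measurable (a j)) (hapos : ∀ u j, 0 < a j u) :
    MemLp (hausdorffSymbol μ Φ a) ∞ volume := by
  refine memLp_top_of_bound ?_ (∫ u, ‖Φ u‖ * (∏ j, a j u) ^ (-((1 : ℝ) / 2)) ∂μ)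
    (.of_forall fun s => ?_)
  · refine AEStronglyMeasurable.integral_prod_right'
      (f := fun p : (Fin n → ℝ) × Ω => Φ p.2 * dilationSymbol (fun j => a j p.2) p.1) ?_
    exact hΦ.comp_snd.mul
      ((measurable_dilationSymbol ha).comp measurable_swap).aestronglyMeasurable
  · refine (norm_integral_le_integral_norm _).trans (le_of_eq (integral_congr_ae ?_))
    refine .of_forall fun u => ?_
    simp only [norm_mul, norm_dilationSymbol (hapos u)]

lemma inner_diagonalizer_hausdorff [SigmaFinite μ] {Φ : Ω → ℂ} (hΦ : AEStronglyMeasurable Φ μ)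
    {a : Fin n → Ω → ℝ} (ha : ∀ j, Measurable (a j)) (hapos : ∀ u j, 0 < a j u)
    (hint : Integrable (fun u => ‖Φ u‖ * (∏ j, a j u) ^ (-((1 : ℝ) / 2))) μ)
    {C : Matrix (Fin n) (Fin n) ℝ} (hC : C * Cᵀ = 1) (e : (Fin n → Bool) ≃ Fin (2 ^ n))
    (k f h : Lp ℂ 2 (volume : Measure (Fin n → ℝ)))
    (hh : ∀ᵐ x, h x = ∫ u, Φ u * f ((C⁻¹ * Matrix.diagonal (fun j => a j u) * C).mulVec x) ∂μ) :
    inner ℂ k h = ∫ s, inner ℂ (diagonalizer hC e k s)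
      (hausdorffSymbol μ Φ a s • diagonalizer hC e f s) := by
  set V := diagonalizer hC e with hV
  choose D hD hDnorm using fun u => exists_dilation hC (hapos u) f
  have hmeas : AEStronglyMeasurable (Function.uncurry fun (u : Ω) (x : Fin n → ℝ) =>
      Φ u * inner ℂ (k x) (f ((C⁻¹ * Matrix.diagonal (fun j => a j u) * C).mulVec x)))
      (μ.prod volume) := by
    refine hΦ.comp_fst.mul (StronglyMeasurable.aestronglyMeasurable ?_)
    refine ((Lp.stronglyMeasurable k).comp_measurable measurable_snd).inner
      ((Lp.stronglyMeasurable f).comp_measurable (measurable_dilation ha C))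
  have hinner : ∀ u, (fun x => inner ℂ (k x)
      (f ((C⁻¹ * Matrix.diagonal (fun j => a j u) * C).mulVec x))) =ᵐ[volume]
      fun x => inner ℂ (k x) (D u x) := fun u => by
    filter_upwards [hD u] with x hx
    rw [hx]
  have hint1 : Integrable (Function.uncurry fun (u : Ω) (x : Fin n → ℝ) =>
      Φ u * inner ℂ (k x) (f ((C⁻¹ * Matrix.diagonal (fun j => a j u) * C).mulVec x)))
      (μ.prod volume) := by
    rw [integrable_prod_iff hmeas]
    refine ⟨.of_forall fun u => ?_, ?_⟩
    · exact ((L2.integrable_inner k (D u)).congr (hinner u).symm).const_mul (Φ u)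
    · refine (hint.mul_const (‖k‖ * ‖f‖)).mono hmeas.norm.integral_prod_right'
        (.of_forall fun u => ?_)
      rw [Real.norm_of_nonneg (integral_nonneg fun _ => norm_nonneg _)]
      simp only [Function.uncurry, norm_mul]
      rw [integral_const_mul]
      have h1 : ∫ x, ‖inner ℂ (k x)
          (f ((C⁻¹ * Matrix.diagonal (fun j => a j u) * C).mulVec x))‖ ≤ ‖k‖ * ‖D u‖ := by
        refine le_trans (le_of_eq (integral_congr_ae ?_)) (integral_norm_inner_le k (D u))
        filter_upwards [hinner u] with x hx
        rw [hx]
      have h0 : 0 ≤ (∏ j, a j u) ^ (-((1 : ℝ) / 2)) :=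
        Real.rpow_nonneg (Finset.prod_nonneg fun j _ => (hapos u j).le) _
      rw [hDnorm] at h1
      rw [Real.norm_of_nonneg h0]
      simp only [norm_norm]
      calc _ ≤ ‖Φ u‖ * (‖k‖ * ((∏ j, a j u) ^ (-((1 : ℝ) / 2)) * ‖f‖)) := by gcongr
        _ = _ := by ring
  have hint2 : Integrable (Function.uncurry fun (u : Ω) (s : Fin n → ℝ) =>
      Φ u * dilationSymbol (fun j => a j u) s * inner ℂ (V k s) (V f s)) (μ.prod volume) := by
    refine (hint.mul_prod (L2.integrable_inner (𝕜 := ℂ) (V k) (V f)).norm).mono ?_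
      (.of_forall fun p => ?_)
    · exact (hΦ.comp_fst.mul (measurable_dilationSymbol ha).aestronglyMeasurable).mul
        (L2.integrable_inner (V k) (V f)).aestronglyMeasurable.comp_snd
    · have h0 : 0 ≤ (∏ j, a j p.1) ^ (-((1 : ℝ) / 2)) :=
        Real.rpow_nonneg (Finset.prod_nonneg fun j _ => (hapos p.1 j).le) _
      simp only [Function.uncurry, norm_mul, norm_dilationSymbol (hapos p.1), norm_norm,
        Real.norm_of_nonneg h0]
      exact le_rfl
  calc inner ℂ k h = ∫ x, inner ℂ (k x) (h x) := L2.inner_def k h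
    _ = ∫ x, ∫ u, Φ u * inner ℂ (k x)
          (f ((C⁻¹ * Matrix.diagonal (fun j => a j u) * C).mulVec x)) ∂μ := by
        refine integral_congr_ae ?_
        filter_upwards [hh] with x hx
        rw [hx, RCLike.inner_apply, ← integral_mul_const]
        simp only [RCLike.inner_apply, mul_assoc]
    _ = ∫ u, ∫ x : Fin n → ℝ, Φ u * inner ℂ (k x)
          (f ((C⁻¹ * Matrix.diagonal (fun j => a j u) * C).mulVec x)) ∂volume ∂μ :=
        (integral_integral_swap hint1).symm
    _ = ∫ u, ∫ s, Φ u * dilationSymbol (fun j => a j u) s * inner ℂ (V k s) (V f s)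
          ∂volume ∂μ := by
        refine integral_congr_ae (.of_forall fun u => ?_)
        have hassoc : ∀ s, Φ u * dilationSymbol (fun j => a j u) s * inner ℂ (V k s) (V f s) =
            Φ u * (dilationSymbol (fun j => a j u) s * inner ℂ (V k s) (V f s)) :=
          fun s => mul_assoc _ _ _
        simp only [hassoc]
        rw [integral_const_mul, integral_const_mul, integral_congr_ae (hinner u), ← L2.inner_def,
          ← V.inner_map_map, L2.inner_def]
        congr 1
        refine integral_congr_ae ?_
        filter_upwards [diagonalizer_dilation hC e (hapos u) (hD u)] with s hs
        rw [hs, inner_smul_right]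
    _ = ∫ s, ∫ u, Φ u * dilationSymbol (fun j => a j u) s * inner ℂ (V k s) (V f s) ∂μ :=
        integral_integral_swap hint2
    _ = _ := by
        refine integral_congr_ae (.of_forall fun s => ?_)
        simp only [integral_mul_const, inner_smul_right, hausdorffSymbol]

end Symbol

/-- An operator that is unitarily equivalent to multiplication by a bounded function is normal. -/
lemma comp_adjoint_comm_of_multiplication {H F α : Type*} [NormedAddCommGroup H]
    [InnerProductSpace ℂ H] [CompleteSpace H] [NormedAddCommGroup F] [InnerProductSpace ℂ F]
    [CompleteSpace F] [MeasurableSpace α] {ν : Measure α} (V : H ≃ₗᵢ[ℂ] Lp F 2 ν) (T : H →L[ℂ] H)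
    {φ : α → ℂ} (hφ : MemLp φ ∞ ν) (hT : ∀ f, V (T f) =ᵐ[ν] fun s => φ s • V f s) :
    T ∘L ContinuousLinearMap.adjoint T = ContinuousLinearMap.adjoint T ∘L T := by
  have hconj : MemLp (fun s => conj (φ s)) ∞ ν := hφ.star
  have hadj : ∀ f, V (ContinuousLinearMap.adjoint T f) =ᵐ[ν] fun s => conj (φ s) • V f s := by
    intro f
    have hmem : MemLp (fun s => conj (φ s) • V f s) 2 ν := (Lp.memLp (V f)).smul hconj
    suffices h : V (ContinuousLinearMap.adjoint T f) = hmem.toLp _ by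
      rw [h]; exact hmem.coeFn_toLp
    refine ext_inner_left ℂ fun k => ?_
    obtain ⟨k, rfl⟩ := V.surjective k
    rw [V.inner_map_map, ContinuousLinearMap.adjoint_inner_right, ← V.inner_map_map,
      L2.inner_def, L2.inner_def]
    refine integral_congr_ae ?_
    filter_upwards [hT k, hmem.coeFn_toLp] with s h1 h2
    rw [h1, h2, inner_smul_left, inner_smul_right]
  ext f
  refine V.injective (Lp.ext ?_)
  filter_upwards [hT (ContinuousLinearMap.adjoint T f), hadj f, hadj (T f), hT f]
    with s h1 h2 h3 h4
  simp only [ContinuousLinearMap.comp_apply]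
  rw [h1, h2, h3, h4, smul_comm]

lemma exists_Lp_two_ne_zero {α : Type*} [MeasurableSpace α] (ν : Measure α) [SigmaFinite ν] :
    ∃ g : Lp ℂ 2 ν, ∀ᵐ x ∂ν, g x ≠ 0 := by
  obtain ⟨w, hw, hwm, hwi⟩ := exists_pos_lintegral_lt_of_sigmaFinite ν (ε := 1) one_ne_zero
  have hmem : MemLp (fun x => ((Real.sqrt (w x) : ℝ) : ℂ)) 2 ν := by
    refine ⟨(Complex.measurable_ofReal.comp
      (hwm.coe_nnreal_real.sqrt)).aestronglyMeasurable, ?_⟩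
    rw [eLpNorm_lt_top_iff_lintegral_rpow_enorm_lt_top (by simp) (by simp)]
    refine lt_of_le_of_lt (le_of_eq (lintegral_congr fun x => ?_)) (hwi.trans ENNReal.one_lt_top)
    rw [← ofReal_norm, ENNReal.toReal_ofNat, ENNReal.rpow_ofNat,
      ← ENNReal.ofReal_pow (norm_nonneg _), Complex.norm_real, Real.norm_eq_abs, sq_abs,
      Real.sq_sqrt (NNReal.coe_nonneg _), ENNReal.ofReal_coe_nnreal]
  refine ⟨hmem.toLp _, ?_⟩
  filter_upwards [hmem.coeFn_toLp] with x hx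
  rw [hx]
  exact_mod_cast ne_of_gt (Real.sqrt_pos.2 (NNReal.coe_pos.2 (hw x)))

/-- A linear operator on `L²` that kills all almost everywhere nonvanishing functions is zero. -/
lemma eq_zero_of_forall_ae_ne_zero {α : Type*} [MeasurableSpace α] {ν : Measure α}
    [SigmaFinite ν] {Y : Type*} [AddCommGroup Y] [Module ℂ Y] (T : Lp ℂ 2 ν →ₗ[ℂ] Y)
    (hT : ∀ f : Lp ℂ 2 ν, (∀ᵐ x ∂ν, f x ≠ 0) → T f = 0) (f : Lp ℂ 2 ν) : T f = 0 := by
  obtain ⟨g, hg⟩ := exists_Lp_two_ne_zero ν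
  have hm : Measurable fun x => -(f x / g x) :=
    ((Lp.stronglyMeasurable f).measurable.div (Lp.stronglyMeasurable g).measurable).neg
  obtain ⟨c, hc⟩ : ∃ c : ℂ, c ∉ {t | 0 < ν {x | -(f x / g x) = t}} := by
    by_contra! h
    exact not_countable_complex
      ((Measure.countable_meas_level_set_pos (μ := ν) hm).mono fun t _ => h t)
  have hfg : ∀ᵐ x ∂ν, (f - (-c) • g) x ≠ 0 := by
    have hc' : ∀ᵐ x ∂ν, -(f x / g x) ≠ c := by
      rw [ae_iff]
      simpa using hc
    filter_upwards [hc', hg, Lp.coeFn_sub f ((-c) • g), Lp.coeFn_smul (-c) g] with x h1 h2 h3 h4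
    rw [h3, Pi.sub_apply, h4, Pi.smul_apply, smul_eq_mul]
    intro h5
    apply h1
    field_simp
    linear_combination -h5
  have h1 := hT _ hfg
  rwa [map_sub, map_smul, hT g hg, smul_zero, sub_zero] at h1

/-- A Hausdorff operator whose kernel is not almost everywhere measurable vanishes, since the
integrals defining it are not integrable. -/
lemma eq_zero_of_not_aestronglyMeasurable {Ω : Type*} [MeasurableSpace Ω] {μ : Measure Ω}
    [SigmaFinite μ] {Φ : Ω → ℂ} (hΦ : ¬ AEStronglyMeasurable Φ μ)
    {a : Fin n → Ω → ℝ} (ha : ∀ j, Measurable (a j)) (hapos : ∀ u j, 0 < a j u)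
    {C : Matrix (Fin n) (Fin n) ℝ} (hC : C * Cᵀ = 1)
    (T : Lp ℂ 2 (volume : Measure (Fin n → ℝ)) →L[ℂ] Lp ℂ 2 (volume : Measure (Fin n → ℝ)))
    (hT : ∀ f : Lp ℂ 2 (volume : Measure (Fin n → ℝ)), ∀ᵐ x, T f x =
      ∫ u, Φ u * f ((C⁻¹ * Matrix.diagonal (fun j => a j u) * C).mulVec x) ∂μ) : T = 0 := by
  ext1 f
  refine eq_zero_of_forall_ae_ne_zero T.toLinearMap (fun f hf => ?_) f
  have hm : Measurable fun p : Ω × (Fin n → ℝ) =>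
      f ((C⁻¹ * Matrix.diagonal (fun j => a j p.1) * C).mulVec p.2) :=
    (Lp.stronglyMeasurable f).measurable.comp (measurable_dilation ha C)
  have hae : ∀ᵐ x : Fin n → ℝ, ∀ᵐ u ∂μ,
      f ((C⁻¹ * Matrix.diagonal (fun j => a j u) * C).mulVec x) ≠ 0 := by
    rw [← Measure.ae_ae_comm (p := fun u x =>
      f ((C⁻¹ * Matrix.diagonal (fun j => a j u) * C).mulVec x) ≠ 0)
      (hm (measurableSet_singleton 0).compl)]
    exact .of_forall fun u => (quasiMeasurePreserving_dilation hC (hapos u)).ae hf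
  refine Lp.ext ?_
  filter_upwards [hT f, hae, Lp.coeFn_zero ℂ 2 (volume : Measure (Fin n → ℝ))] with x h1 h2 h3
  change T f x = _
  rw [h1, h3]
  refine integral_undef fun h4 => hΦ ?_
  refine (h4.aestronglyMeasurable.mul
    (hm.comp (measurable_id.prodMk (measurable_const (a := x)))).inv.aestronglyMeasurable).congr ?_
  filter_upwards [h2] with u hu
  simp [hu]

/-- A Hausdorff operator is diagonalized by `diagonalizer`. -/
lemma diagonalizer_hausdorff {Ω : Type*} [MeasurableSpace Ω] {μ : Measure Ω}
    [SigmaFinite μ] {Φ : Ω → ℂ} (hΦ : AEStronglyMeasurable Φ μ)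
    {a : Fin n → Ω → ℝ} (ha : ∀ j, Measurable (a j)) (hapos : ∀ u j, 0 < a j u)
    (hint : Integrable (fun u => ‖Φ u‖ * (∏ j, a j u) ^ (-((1 : ℝ) / 2))) μ)
    {C : Matrix (Fin n) (Fin n) ℝ} (hC : C * Cᵀ = 1) (e : (Fin n → Bool) ≃ Fin (2 ^ n))
    (f h : Lp ℂ 2 (volume : Measure (Fin n → ℝ)))
    (hh : ∀ᵐ x, h x = ∫ u, Φ u * f ((C⁻¹ * Matrix.diagonal (fun j => a j u) * C).mulVec x) ∂μ) :
    diagonalizer hC e h =ᵐ[volume]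
      fun s => hausdorffSymbol μ Φ a s • diagonalizer hC e f s := by
  have hmem : MemLp (fun s => hausdorffSymbol μ Φ a s • diagonalizer hC e f s) 2 volume :=
    (Lp.memLp (diagonalizer hC e f)).smul (memLp_hausdorffSymbol hΦ ha hapos)
  suffices heq : diagonalizer hC e h = hmem.toLp _ by
    rw [heq]; exact hmem.coeFn_toLp
  refine ext_inner_left ℂ fun k => ?_
  obtain ⟨k, rfl⟩ := (diagonalizer hC e).surjective k
  rw [LinearIsometryEquiv.inner_map_map,
    inner_diagonalizer_hausdorff hΦ ha hapos hint hC e k f h hh, L2.inner_def]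
  refine integral_congr_ae ?_
  filter_upwards [hmem.coeFn_toLp] with s hs
  rw [hs]

/-- The structure theorem when all eigenvalues are positive everywhere. -/
lemma normal_structure_of_pos {Ω : Type*} [MeasurableSpace Ω] {μ : Measure Ω}
    [SigmaFinite μ] {Φ : Ω → ℂ}
    {a : Fin n → Ω → ℝ} (ha : ∀ j, Measurable (a j)) (hapos : ∀ u j, 0 < a j u)
    (hint : Integrable (fun u => ‖Φ u‖ * (∏ j, a j u) ^ (-((1 : ℝ) / 2))) μ)
    {C : Matrix (Fin n) (Fin n) ℝ} (hC : C * Cᵀ = 1) (e : (Fin n → Bool) ≃ Fin (2 ^ n))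
    (T : Lp ℂ 2 (volume : Measure (Fin n → ℝ)) →L[ℂ] Lp ℂ 2 (volume : Measure (Fin n → ℝ)))
    (hT : ∀ f : Lp ℂ 2 (volume : Measure (Fin n → ℝ)), ∀ᵐ x, T f x =
      ∫ u, Φ u * f ((C⁻¹ * Matrix.diagonal (fun j => a j u) * C).mulVec x) ∂μ) :
    T ∘L ContinuousLinearMap.adjoint T = ContinuousLinearMap.adjoint T ∘L T ∧
    ∀ f, diagonalizer hC e (T f) =ᵐ[volume]
      fun s => hausdorffSymbol μ Φ a s • diagonalizer hC e f s := by
  by_cases hΦ : AEStronglyMeasurable Φ μ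
  · have h := fun f => diagonalizer_hausdorff hΦ ha hapos hint hC e f (T f) (hT f)
    exact ⟨comp_adjoint_comm_of_multiplication _ T (memLp_hausdorffSymbol hΦ ha hapos) h, h⟩
  · have h0 := eq_zero_of_not_aestronglyMeasurable hΦ ha hapos hC T hT
    have hφ : ∀ s, hausdorffSymbol μ Φ a s = 0 := by
      refine fun s => integral_undef fun h1 => hΦ ?_
      refine (h1.aestronglyMeasurable.mul ((measurable_dilationSymbol ha).comp
        (measurable_id.prodMk (measurable_const (a := s)))).inv.aestronglyMeasurable).congr ?_
      refine .of_forall fun u => ?_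
      have hne : dilationSymbol (fun j => a j u) s ≠ 0 := by
        rw [← norm_ne_zero_iff, norm_dilationSymbol (hapos u)]
        exact (Real.rpow_pos_of_pos (Finset.prod_pos fun j _ => hapos u j) _).ne'
      simp [hne]
    subst h0
    refine ⟨by simp, fun f => ?_⟩
    simp only [hφ, zero_smul, _root_.zero_apply, map_zero]
    exact Lp.coeFn_zero _ _ _

end HausdorffOperator

end

/-- Structure theorem for normal Hausdorff operators on `L²(ℝⁿ)`: a Hausdorff operator whose
matrix family is simultaneously diagonalizable by an orthogonal matrix `C` with positive
eigenvalues `a_j(u)` is normal and unitarily equivalent to multiplication by its symbol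
`φ(s) = ∫ Φ(u) ∏_j a_j(u)^{-1/2 - i s_j} dμ(u)` on `L²(ℝⁿ; ℂ^{2^n})`. -/
theorem hausdorff_normal_structure {Ω : Type*} [MeasurableSpace Ω] (μ : Measure Ω)
    [SigmaFinite μ] (n : ℕ)
    (Φ : Ω → ℂ) (A : Ω → Matrix (Fin n) (Fin n) ℝ)
    (C : Matrix (Fin n) (Fin n) ℝ) (hC : C * Cᵀ = 1)
    (a : Fin n → Ω → ℝ) (ha : ∀ j, Measurable (a j))
    (hapos : ∀ᵐ u ∂μ, Φ u ≠ 0 → ∀ j, 0 < a j u)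
    (hdiag : ∀ᵐ u ∂μ, Φ u ≠ 0 → A u = C⁻¹ * Matrix.diagonal (fun j => a j u) * C)
    (hint : Integrable (fun u => ‖Φ u‖ * (∏ j, a j u) ^ (-((1 : ℝ) / 2))) μ)
    (T : Lp ℂ 2 (volume : Measure (Fin n → ℝ)) →L[ℂ] Lp ℂ 2 (volume : Measure (Fin n → ℝ)))
    (hT : ∀ f : Lp ℂ 2 (volume : Measure (Fin n → ℝ)),
      ∀ᵐ x : Fin n → ℝ ∂volume, T f x = ∫ u, Φ u * f ((A u).mulVec x) ∂μ) :
    T ∘L ContinuousLinearMap.adjoint T = ContinuousLinearMap.adjoint T ∘L T ∧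
    ∃ V : Lp ℂ 2 (volume : Measure (Fin n → ℝ)) ≃ₗᵢ[ℂ]
        Lp (EuclideanSpace ℂ (Fin (2 ^ n))) 2 (volume : Measure (Fin n → ℝ)),
      ∀ f : Lp ℂ 2 (volume : Measure (Fin n → ℝ)),
        ∀ᵐ s : Fin n → ℝ ∂volume,
          V (T f) s =
            (∫ u, Φ u * ∏ j, (a j u : ℂ) ^ (-(1 / 2 : ℂ) - Complex.I * (s j : ℂ)) ∂μ) •
              V f s := by
  have e : (Fin n → Bool) ≃ Fin (2 ^ n) := Fintype.equivFinOfCardEq (by simp)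
  set a' : Fin n → Ω → ℝ := fun j u => if 0 < a j u then a j u else 1 with ha'_def
  have ha' : ∀ j, Measurable (a' j) := fun j =>
    Measurable.ite (measurableSet_lt measurable_const (ha j)) (ha j) measurable_const
  have ha'pos : ∀ u j, 0 < a' j u := fun u j => by
    by_cases h : 0 < a j u <;> simp [ha'_def, h]
  have haa' : ∀ᵐ u ∂μ, Φ u ≠ 0 → ∀ j, a' j u = a j u := by
    filter_upwards [hapos] with u hu h j
    simp [ha'_def, hu h j]
  have hint' : Integrable (fun u => ‖Φ u‖ * (∏ j, a' j u) ^ (-((1 : ℝ) / 2))) μ := by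
    refine hint.congr ?_
    filter_upwards [haa'] with u hu
    by_cases h : Φ u = 0
    · simp [h]
    · simp only [hu h]
  have hT' : ∀ f : Lp ℂ 2 (volume : Measure (Fin n → ℝ)), ∀ᵐ x, T f x =
      ∫ u, Φ u * f ((C⁻¹ * Matrix.diagonal (fun j => a' j u) * C).mulVec x) ∂μ := by
    intro f
    filter_upwards [hT f] with x hx
    rw [hx]
    refine integral_congr_ae ?_
    filter_upwards [haa', hdiag] with u hu hA
    by_cases h : Φ u = 0
    · simp [h]
    · simp only [hu h, hA h]
  have hφ : ∀ s : Fin n → ℝ, HausdorffOperator.hausdorffSymbol μ Φ a' s =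
      ∫ u, Φ u * ∏ j, (a j u : ℂ) ^ (-(1 / 2 : ℂ) - Complex.I * (s j : ℂ)) ∂μ := by
    intro s
    refine integral_congr_ae ?_
    filter_upwards [haa'] with u hu
    by_cases h : Φ u = 0
    · simp [h]
    · simp only [hu h, HausdorffOperator.dilationSymbol]
  obtain ⟨hnormal, hV⟩ := HausdorffOperator.normal_structure_of_pos ha' ha'pos hint' hC e T hT'
  refine ⟨hnormal, HausdorffOperator.diagonalizer hC e, fun f => ?_⟩
  filter_upwards [hV f] with s hs
  rw [hs, hφ]
end
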